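/- arXiv:1808.10422 — 12 statements merged into one kernel-verified Lean document; each statement's English description precedes it below -/
import Mathlib

section
/- Let x and y be noncommuting indeterminates and let d ≥ 1 be an integer. Every symmetric free polynomial in ℂ⟨x,y⟩ that is homogeneous of total degree d can be written as a polynomial in the d elements u, v², vuv, v u² v, …, v u^{d−2} v; that is, it lies in the unital subalgebra of ℂ⟨x,y⟩ generated by u, v², vuv, …, v u^{d−2} v. -/
open Topology

noncomputable section

/-- The free algebra `ℂ⟨x,y⟩`, realized as the monoid algebra of the free monoid on two
letters (so a free polynomial is a finitely supported linear combination of words). -/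
abbrev FA2 : Type := MonoidAlgebra ℂ (FreeMonoid Bool)

/-- The generator `x` of `ℂ⟨x,y⟩`. -/
noncomputable def Xg : FA2 := MonoidAlgebra.of ℂ (FreeMonoid Bool) (FreeMonoid.of false)

/-- The generator `y` of `ℂ⟨x,y⟩`. -/
noncomputable def Yg : FA2 := MonoidAlgebra.of ℂ (FreeMonoid Bool) (FreeMonoid.of true)

/-- The automorphism of `ℂ⟨x,y⟩` interchanging `x` and `y`. -/
noncomputable def swapA : FA2 →ₐ[ℂ] FA2 :=
  MonoidAlgebra.mapDomainAlgHom ℂ ℂ (FreeMonoid.map not)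

/-- `u = ½(x + y)`. -/
noncomputable def uP : FA2 := (1/2 : ℂ) • (Xg + Yg)

/-- `v = ½(x - y)`. -/
noncomputable def vP : FA2 := (1/2 : ℂ) • (Xg - Yg)

/-- The subspace of free polynomials homogeneous of total degree `d`: the span of the
words of length `d`. -/
noncomputable def homog (d : ℕ) : Submodule ℂ FA2 :=
  Submodule.span ℂ
    ((fun w => (MonoidAlgebra.of ℂ (FreeMonoid Bool) w : FA2)) ''
      {w : FreeMonoid Bool | (FreeMonoid.toList w).length = d})

lemma swap_X : swapA Xg = Yg := by
  simp [swapA, Xg, Yg, MonoidAlgebra.mapDomainAlgHom]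

lemma swap_Y : swapA Yg = Xg := by
  simp [swapA, Xg, Yg, MonoidAlgebra.mapDomainAlgHom]

lemma swap_u : swapA uP = uP := by
  rw [uP, map_smul, map_add, swap_X, swap_Y, add_comm]

lemma swap_v : swapA vP = -vP := by
  rw [vP, map_smul, map_sub, swap_X, swap_Y, ← smul_neg, neg_sub]

lemma X_eq : Xg = uP + vP := by
  simp only [uP, vP]; module

lemma Y_eq : Yg = uP - vP := by
  simp only [uP, vP]; module

/-- The subalgebra of the theorem. -/
def AA (d : ℕ) : Subalgebra ℂ FA2 := Algebra.adjoin ℂ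
      ({uP} ∪ {z : FA2 | ∃ j : ℕ, j + 2 ≤ d ∧ z = vP * uP ^ j * vP})

/-- The odd companion: span of `u^k v c` with `c` in the subalgebra and `k < n`. -/
def BB (d n : ℕ) : Submodule ℂ FA2 := Submodule.span ℂ
  {z : FA2 | ∃ k : ℕ, k + 1 ≤ n ∧ ∃ c ∈ AA d, z = uP ^ k * vP * c}

lemma u_mem (d : ℕ) : uP ∈ AA d := Algebra.subset_adjoin (Or.inl rfl)

lemma vuv_mem (d j : ℕ) (h : j + 2 ≤ d) : vP * uP ^ j * vP ∈ AA d :=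
  Algebra.subset_adjoin (Or.inr ⟨j, h, rfl⟩)

lemma swap_A (d : ℕ) (a : FA2) (h : a ∈ AA d) : swapA a = a := by
  have : AA d ≤ AlgHom.equalizer swapA (AlgHom.id ℂ FA2) := by
    refine Algebra.adjoin_le ?_
    rintro z (rfl | ⟨j, -, rfl⟩)
    · exact swap_u
    · change swapA _ = _
      simp [swap_u, swap_v]
  exact this h

lemma swap_B (d n : ℕ) (b : FA2) (h : b ∈ BB d n) : swapA b = -b := by
  induction h using Submodule.span_induction with
  | mem z hz =>
    obtain ⟨k, -, c, hc, rfl⟩ := hz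
    simp [swap_u, swap_v, swap_A d c hc]
  | zero => simp
  | add x y _ _ hx hy => rw [map_add, hx, hy, neg_add]
  | smul r x _ hx => rw [map_smul, hx, smul_neg]

lemma u_B (d n : ℕ) (b : FA2) (h : b ∈ BB d n) : uP * b ∈ BB d (n + 1) := by
  induction h using Submodule.span_induction with
  | mem z hz =>
    obtain ⟨k, hk, c, hc, rfl⟩ := hz
    exact Submodule.subset_span ⟨k + 1, by omega, c, hc, by simp only [pow_succ', mul_assoc]⟩
  | zero => simp
  | add x y _ _ hx hy => rw [mul_add]; exact add_mem hx hy
  | smul r x _ hx => rw [mul_smul_comm]; exact Submodule.smul_mem _ _ hx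

lemma v_B (d n : ℕ) (hn : n + 1 ≤ d) (b : FA2) (h : b ∈ BB d n) : vP * b ∈ AA d := by
  induction h using Submodule.span_induction with
  | mem z hz =>
    obtain ⟨k, hk, c, hc, rfl⟩ := hz
    have := mul_mem (vuv_mem d k (by omega)) hc
    simpa only [mul_assoc] using this
  | zero => simp
  | add x y _ _ hx hy => rw [mul_add]; exact add_mem hx hy
  | smul r x _ hx => rw [mul_smul_comm]; exact Subalgebra.smul_mem _ hx _

lemma word_decomp (d : ℕ) (l : List Bool) (h : l.length ≤ d) :
    ∃ a ∈ AA d, ∃ b ∈ BB d l.length,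
      (MonoidAlgebra.of ℂ (FreeMonoid Bool) (FreeMonoid.ofList l) : FA2) = a + b := by
  induction l with
  | nil => exact ⟨1, one_mem _, 0, zero_mem _, by rw [FreeMonoid.ofList_nil, map_one, add_zero]⟩
  | cons t l ih =>
    rw [List.length_cons] at h
    obtain ⟨a, ha, b, hb, e⟩ := ih (by omega)
    have hua : uP * a ∈ AA d := mul_mem (u_mem d) ha
    have hvb := v_B d _ h b hb
    have hub := u_B d _ b hb
    have hva : vP * a ∈ BB d (l.length + 1) :=
      Submodule.subset_span ⟨0, by omega, a, ha, by simp⟩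
    rw [FreeMonoid.ofList_cons, map_mul, e, List.length_cons]
    cases t with
    | false =>
      refine ⟨_, add_mem hua hvb, _, add_mem hub hva, ?_⟩
      change Xg * _ = _
      rw [X_eq]; noncomm_ring
    | true =>
      refine ⟨_, sub_mem hua hvb, _, sub_mem hub hva, ?_⟩
      change Yg * _ = _
      rw [Y_eq]; noncomm_ring

lemma homog_decomp (d : ℕ) (p : FA2) (h : p ∈ homog d) :
    ∃ a ∈ AA d, ∃ b ∈ BB d d, p = a + b := by
  induction h using Submodule.span_induction with
  | mem z hz =>
    obtain ⟨w, hw, rfl⟩ := hz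
    have hw' : (FreeMonoid.toList w).length = d := hw
    have := word_decomp d (FreeMonoid.toList w) hw'.le
    rwa [hw'] at this
  | zero => exact ⟨0, zero_mem _, 0, zero_mem _, by simp⟩
  | add x y _ _ hx hy =>
    obtain ⟨a, ha, b, hb, rfl⟩ := hx
    obtain ⟨a', ha', b', hb', rfl⟩ := hy
    exact ⟨_, add_mem ha ha', _, add_mem hb hb', by abel⟩
  | smul r x _ hx =>
    obtain ⟨a, ha, b, hb, rfl⟩ := hx
    exact ⟨_, Subalgebra.smul_mem _ ha r, _, Submodule.smul_mem _ r hb, smul_add _ _ _⟩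

/-- Every symmetric free polynomial in `ℂ⟨x,y⟩` homogeneous of total degree `d ≥ 1` lies in
the unital subalgebra generated by the `d` elements `u, v², vuv, …, v u^(d-2) v`
(i.e. `u` together with `v * u^j * v` for `j + 2 ≤ d`; the case `j = 0` gives `v²`). -/
theorem symmetric_homogeneous_mem_adjoin (d : ℕ) (hd : 1 ≤ d) (p : FA2)
    (hsym : swapA p = p) (hhom : p ∈ homog d) :
    p ∈ Algebra.adjoin ℂ
      ({uP} ∪ {z : FA2 | ∃ j : ℕ, j + 2 ≤ d ∧ z = vP * uP ^ j * vP}) := by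
  obtain ⟨a, ha, b, hb, rfl⟩ := homog_decomp d p hhom
  rw [map_add, swap_A d a ha, swap_B d d b hb] at hsym
  have h1 : -b = b := add_left_cancel hsym
  have h2 : (2 : ℂ) • b = 0 := by
    rw [two_smul]; nth_rewrite 1 [← h1]; exact neg_add_cancel b
  have hb0 : b = 0 := (smul_eq_zero.mp h2).resolve_left two_ne_zero
  rw [hb0, add_zero]
  exact ha
end
end

section
/- Let p ∈ ℂ[X] be a polynomial and let D ⊆ M¹ be open in the free topology. The closure, in the relative free topology of D, of the set T = {x ∈ D : p(x) = 0} is exactly the set {x ∈ D : p(x) is singular}. -/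
open Topology

noncomputable section

/-- The operator norm of a rectangular complex matrix, i.e. the norm of the induced
linear map between Euclidean spaces. -/
noncomputable def opNorm {m n : Type*} [Fintype m] [Fintype n] [DecidableEq n]
    (A : Matrix m n ℂ) : ℝ :=
  ‖LinearMap.toContinuousLinearMap (Matrix.toEuclideanLin A)‖

/-- `M¹`: the disjoint union over `n ≥ 1` of the `n × n` complex matrices. -/
def M1 : Type := Σ n : ℕ, Matrix (Fin (n + 1)) (Fin (n + 1)) ℂ

/-- Block evaluation `δ(x)` of an `I × J` matrix of one-variable polynomials at a
square matrix `x`. -/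
noncomputable def evalDelta1 {I J n : ℕ} (δ : Matrix (Fin I) (Fin J) (Polynomial ℂ))
    (x : Matrix (Fin n) (Fin n) ℂ) : Matrix (Fin I × Fin n) (Fin J × Fin n) ℂ :=
  Matrix.of fun p q => (Polynomial.aeval x (δ p.1 q.1)) p.2 q.2

/-- The basic free open set `B_δ = {x ∈ M¹ : ‖δ(x)‖ < 1}`. -/
noncomputable def Bdelta1 {I J : ℕ} (δ : Matrix (Fin I) (Fin J) (Polynomial ℂ)) : Set M1 :=
  { x | opNorm (evalDelta1 δ x.2) < 1 }

/-- The free topology on `M¹`: the topology with the sets `B_δ` as a basis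
(the `B_δ` are closed under pairwise intersection, so generating from them as a
subbasis yields the topology having them as a basis). -/
def freeTopology1 : TopologicalSpace M1 :=
  TopologicalSpace.generateFrom
    { U | ∃ (I J : ℕ) (δ : Matrix (Fin I) (Fin J) (Polynomial ℂ)), U = Bdelta1 δ }

instance : TopologicalSpace M1 := freeTopology1

/-- The `1 × 1` matrix with entry `l`, as a point of `M1`. -/
def scal (l : ℂ) : M1 := ⟨0, Matrix.of fun _ _ => l⟩

/-- The elementary tensor `u ⊗ v`. -/
def tens {J n : ℕ} (u : EuclideanSpace ℂ (Fin J × Fin 1)) (v : Fin n → ℂ) :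
    EuclideanSpace ℂ (Fin J × Fin n) :=
  WithLp.toLp 2 fun q => u (q.1, 0) * v q.2

lemma norm_tens {J n : ℕ} (u : EuclideanSpace ℂ (Fin J × Fin 1)) (v : Fin n → ℂ) :
    ‖tens u v‖ = ‖u‖ * ‖(WithLp.toLp 2 v : EuclideanSpace ℂ (Fin n))‖ := by
  rw [← sq_eq_sq₀ (norm_nonneg _) (by positivity), mul_pow, EuclideanSpace.norm_sq_eq,
    EuclideanSpace.norm_sq_eq, EuclideanSpace.norm_sq_eq, Fintype.sum_prod_type,
    Fintype.sum_prod_type, Finset.sum_mul_sum]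
  simp [tens, mul_pow]

lemma aeval_mulVec {n : ℕ} (x : Matrix (Fin n) (Fin n) ℂ) (l : ℂ) (v : Fin n → ℂ)
    (h : x.mulVec v = l • v) (q : Polynomial ℂ) :
    (Polynomial.aeval x q).mulVec v = q.eval l • v := by
  have hpow : ∀ k : ℕ, (x ^ k).mulVec v = l ^ k • v := by
    intro k
    induction k with
    | zero => simp
    | succ k ih =>
      rw [pow_succ, ← Matrix.mulVec_mulVec, h, Matrix.mulVec_smul, ih, smul_smul, pow_succ,
        mul_comm]
  induction q using Polynomial.induction_on' with
  | add a b ha hb => simp [Matrix.add_mulVec, ha, hb, add_smul]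
  | monomial k a =>
    rw [Polynomial.aeval_monomial, ← Matrix.mulVec_mulVec, hpow, Matrix.mulVec_smul,
      Algebra.algebraMap_eq_smul_one, Matrix.smul_mulVec, Matrix.one_mulVec,
      Polynomial.eval_monomial, smul_smul, mul_comm]

lemma aeval_scal (l : ℂ) (q : Polynomial ℂ) (i j : Fin 1) :
    (Polynomial.aeval (Matrix.of fun _ _ => l : Matrix (Fin 1) (Fin 1) ℂ) q) i j = q.eval l := by
  have h := aeval_mulVec (Matrix.of fun _ _ => l : Matrix (Fin 1) (Fin 1) ℂ) l (fun _ => 1)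
    (by ext i; simp [Matrix.mulVec, dotProduct]) q
  have := congrFun h i
  rw [Subsingleton.elim j 0]
  simpa [Matrix.mulVec, dotProduct] using this

lemma opNorm_scal_le {I J n : ℕ} (δ : Matrix (Fin I) (Fin J) (Polynomial ℂ))
    (x : Matrix (Fin n) (Fin n) ℂ) (l : ℂ) (v : Fin n → ℂ) (hv : v ≠ 0)
    (h : x.mulVec v = l • v) :
    opNorm (evalDelta1 δ (Matrix.of fun _ _ => l : Matrix (Fin 1) (Fin 1) ℂ)) ≤
      opNorm (evalDelta1 δ x) := by
  have hv' : 0 < ‖(WithLp.toLp 2 v : EuclideanSpace ℂ (Fin n))‖ := by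
    rw [norm_pos_iff]
    intro h0
    exact hv (by simpa using h0)
  refine ContinuousLinearMap.opNorm_le_bound _ (norm_nonneg _) fun u => ?_
  have key : Matrix.toEuclideanLin (evalDelta1 δ x) (tens u v) =
      tens (Matrix.toEuclideanLin
        (evalDelta1 δ (Matrix.of fun _ _ => l : Matrix (Fin 1) (Fin 1) ℂ)) u) v := by
    ext ⟨i, k⟩
    simp only [Matrix.toEuclideanLin, Matrix.toLpLin_apply, tens, Matrix.mulVec, dotProduct,
      evalDelta1, Matrix.of_apply, Fintype.sum_prod_type, aeval_scal, Finset.sum_mul]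
    refine Finset.sum_congr rfl fun j _ => ?_
    have := congrFun (aeval_mulVec x l v h (δ i j)) k
    simp only [Matrix.mulVec, dotProduct, Pi.smul_apply, smul_eq_mul] at this
    simp only [Fin.sum_univ_one, Fin.isValue, Finset.univ_unique, Finset.sum_singleton,
      Fin.default_eq_zero]
    calc _ = u (j, 0) * ∑ m, (Polynomial.aeval x (δ i j)) k m * v m := by
          rw [Finset.mul_sum]; exact Finset.sum_congr rfl fun m _ => by ring
      _ = _ := by rw [this]; ring
  have hb := ContinuousLinearMap.le_opNorm
    (LinearMap.toContinuousLinearMap (Matrix.toEuclideanLin (evalDelta1 δ x))) (tens u v)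
  rw [LinearMap.coe_toContinuousLinearMap', key, norm_tens, norm_tens, ← mul_assoc] at hb
  exact le_of_mul_le_mul_right hb hv'

lemma scal_mem_of_isOpen (x : M1) (l : ℂ) (v : Fin (x.1 + 1) → ℂ) (hv : v ≠ 0)
    (h : x.2.mulVec v = l • v) (U : Set M1) (hU : IsOpen U) (hx : x ∈ U) : scal l ∈ U := by
  induction hU with
  | basic s hs =>
    obtain ⟨I, J, δ, rfl⟩ := hs
    exact lt_of_le_of_lt (opNorm_scal_le δ x.2 l v hv h) hx
  | univ => trivial
  | inter s t _ _ hs ht => exact ⟨hs hx.1, ht hx.2⟩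
  | sUnion S _ ih =>
    obtain ⟨s, hs, hxs⟩ := hx
    exact ⟨s, hs, ih s hs hxs⟩

lemma exists_eigen {n : ℕ} (x : Matrix (Fin (n + 1)) (Fin (n + 1)) ℂ) (p : Polynomial ℂ)
    (hp : ¬ IsUnit (Polynomial.aeval x p)) :
    ∃ (l : ℂ) (v : Fin (n + 1) → ℂ), v ≠ 0 ∧ x.mulVec v = l • v ∧ p.eval l = 0 := by
  have h0 : (0 : ℂ) ∈ spectrum ℂ (Polynomial.aeval x p) := spectrum.zero_mem ℂ hp
  rw [spectrum.map_polynomial_aeval_of_nonempty x p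
    (spectrum.nonempty_of_isAlgClosed_of_finiteDimensional ℂ x)] at h0
  obtain ⟨l, hl, hpl⟩ := h0
  rw [spectrum.mem_iff, Matrix.isUnit_iff_isUnit_det, isUnit_iff_ne_zero, not_not] at hl
  obtain ⟨v, hv, hvl⟩ := Matrix.exists_mulVec_eq_zero_iff.mpr hl
  refine ⟨l, v, hv, ?_, hpl⟩
  rw [Matrix.sub_mulVec, Algebra.algebraMap_eq_smul_one, Matrix.smul_mulVec,
    Matrix.one_mulVec, sub_eq_zero] at hvl
  exact hvl.symm

lemma opNorm_eval_zero {n : ℕ} (x : Matrix (Fin n) (Fin n) ℂ) (q : Polynomial ℂ)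
    (h : Polynomial.aeval x q = 0) :
    opNorm (evalDelta1 (Matrix.of fun _ _ => q : Matrix (Fin 1) (Fin 1) (Polynomial ℂ)) x) < 1 := by
  have : evalDelta1 (Matrix.of fun _ _ => q : Matrix (Fin 1) (Fin 1) (Polynomial ℂ)) x = 0 := by
    ext a b
    simp [evalDelta1, h]
  rw [this]
  simp [opNorm]

lemma opNorm_eval_one {n : ℕ} (x : Matrix (Fin (n + 1)) (Fin (n + 1)) ℂ) (q : Polynomial ℂ)
    (h : Polynomial.aeval x q = 1) :
    opNorm (evalDelta1 (Matrix.of fun _ _ => q : Matrix (Fin 1) (Fin 1) (Polynomial ℂ)) x) = 1 := by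
  have : evalDelta1 (Matrix.of fun _ _ => q : Matrix (Fin 1) (Fin 1) (Polynomial ℂ)) x = 1 := by
    ext ⟨a, b⟩ ⟨c, d⟩
    rw [Subsingleton.elim c a]
    simp [evalDelta1, h, Matrix.one_apply]
  rw [this]
  have h1 : LinearMap.toContinuousLinearMap
      (Matrix.toEuclideanLin (1 : Matrix (Fin 1 × Fin (n + 1)) (Fin 1 × Fin (n + 1)) ℂ)) =
      ContinuousLinearMap.id ℂ _ := by
    ext u i
    simp [Matrix.toEuclideanLin, Matrix.toLpLin_apply]
  rw [opNorm, h1]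
  exact ContinuousLinearMap.norm_id

/-- Let `p ∈ ℂ[X]` and let `D ⊆ M¹` be freely open.  The closure, in the relative free
topology of `D`, of the set `T = {x ∈ D : p(x) = 0}` is exactly
`{x ∈ D : p(x) is singular}`. -/
theorem free_closure_variety_eq_singular (p : Polynomial ℂ) (D : Set M1) (hD : IsOpen D) :
    closure {x : D | Polynomial.aeval (x : M1).2 p = 0} =
      {x : D | ¬ IsUnit (Polynomial.aeval (x : M1).2 p)} := by
  ext x
  rw [mem_closure_iff]
  constructor
  · intro hx hu
    set A := Polynomial.aeval (x : M1).2 p with hA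
    have hc : A.charpoly.eval 0 ≠ 0 := by
      intro h0
      rw [Matrix.isUnit_iff_isUnit_det, isUnit_iff_ne_zero, Matrix.det_eq_sign_charpoly_coeff,
        Polynomial.coeff_zero_eq_eval_zero, h0, mul_zero] at hu
      exact hu rfl
    let q : Polynomial ℂ := Polynomial.C (A.charpoly.eval 0)⁻¹ * A.charpoly.comp p
    let δ : Matrix (Fin 1) (Fin 1) (Polynomial ℂ) := Matrix.of fun _ _ => q
    have hopen : IsOpen (Bdelta1 δ) := TopologicalSpace.isOpen_generateFrom_of_mem ⟨1, 1, δ, rfl⟩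
    obtain ⟨y, hy1, hy2⟩ := hx _ (hopen.preimage continuous_subtype_val) (by
      refine opNorm_eval_zero _ q ?_
      rw [map_mul, Polynomial.aeval_comp, ← hA, Matrix.aeval_self_charpoly, mul_zero])
    refine (ne_of_lt (show opNorm (evalDelta1 δ (y : M1).2) < 1 from hy1))
      (opNorm_eval_one _ q ?_)
    have hy2' : Polynomial.aeval (y : M1).2 p = 0 := hy2
    rw [map_mul, Polynomial.aeval_comp, hy2', Polynomial.aeval_C,
      ← Polynomial.coeff_zero_eq_aeval_zero', ← map_mul, Polynomial.coeff_zero_eq_eval_zero,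
      inv_mul_cancel₀ hc, map_one]
  · intro hx o ho hxo
    obtain ⟨l, v, hv, hvl, hpl⟩ := exists_eigen _ p hx
    obtain ⟨U, hU, rfl⟩ := isOpen_induced_iff.mp ho
    refine ⟨⟨scal l, scal_mem_of_isOpen _ l v hv hvl D hD x.2⟩,
      scal_mem_of_isOpen _ l v hv hvl U hU hxo, ?_⟩
    show Polynomial.aeval (Matrix.of fun _ _ => l : Matrix (Fin 1) (Fin 1) ℂ) p = 0
    ext i j
    rw [aeval_scal, hpl]; rfl
end
end

section
/- For every nonconstant polynomial p ∈ ℂ[X], the set {x ∈ M¹ : p(x) = 0} is not closed in the free topology on M¹. -/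
open Topology

noncomputable section

theorem aeval_diag {n : ℕ} (d : Fin n → ℂ) (q : Polynomial ℂ) :
    Polynomial.aeval (Matrix.diagonal d) q = Matrix.diagonal (fun i => q.eval (d i)) := by
  have h := Polynomial.aeval_algHom_apply (Matrix.diagonalAlgHom (n := Fin n) (α := ℂ) ℂ) d q
  have h2 : Polynomial.aeval d q = fun i => q.eval (d i) := by
    ext i
    have := Polynomial.aeval_algHom_apply (Pi.evalAlgHom ℂ (fun _ : Fin n => ℂ) i) d q
    simpa [Polynomial.aeval_def, Polynomial.eval₂_eq_eval_map] using this.symm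
  rw [h2] at h
  exact h

theorem opNorm_compress {I J : ℕ} (δ : Matrix (Fin I) (Fin J) (Polynomial ℂ)) (a b : ℂ) :
    opNorm (evalDelta1 δ (Matrix.diagonal (fun _ : Fin 1 => a))) ≤
      opNorm (evalDelta1 δ (Matrix.diagonal ![a, b])) := by
  refine ContinuousLinearMap.opNorm_le_bound _ (norm_nonneg _) fun v => ?_
  let w : EuclideanSpace ℂ (Fin J × Fin 2) :=
    WithLp.toLp 2 fun jk => if jk.2 = 0 then v (jk.1, 0) else 0
  have hw : ‖w‖ = ‖v‖ := by
    simp [EuclideanSpace.norm_eq, w, Fintype.sum_prod_type]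
  have h := (LinearMap.toContinuousLinearMap (Matrix.toEuclideanLin
    (evalDelta1 δ (Matrix.diagonal ![a, b])))).le_opNorm w
  rw [hw] at h
  refine le_trans ?_ h
  rw [EuclideanSpace.norm_eq, EuclideanSpace.norm_eq]
  apply Real.sqrt_le_sqrt
  simp only [Fintype.sum_prod_type, Fin.sum_univ_two, Fin.sum_univ_one]
  refine Finset.sum_le_sum fun i _ => ?_
  refine le_trans (le_of_eq ?_) (le_add_of_nonneg_right (by positivity))
  congr 2
  simp [Matrix.toLpLin_apply, Matrix.mulVec, dotProduct, evalDelta1, aeval_diag,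
    Fintype.sum_prod_type, w]

/-- For every nonconstant polynomial `p ∈ ℂ[X]`, the set `{x ∈ M¹ : p(x) = 0}` is not
closed in the free topology on `M¹`. -/
theorem free_variety_not_closed (p : Polynomial ℂ) (hp : 0 < p.natDegree) :
    ¬ IsClosed {x : M1 | Polynomial.aeval x.2 p = 0} := by
  intro hc
  obtain ⟨a, ha⟩ := Complex.exists_root (Polynomial.natDegree_pos_iff_degree_pos.mp hp)
  have hp0 : p ≠ 0 := by
    rintro rfl
    simp at hp
  obtain ⟨b, hb⟩ : ∃ b, p.eval b ≠ 0 := by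
    by_contra! h
    exact hp0 (Polynomial.funext (by simpa using h))
  let y : M1 := ⟨0, Matrix.diagonal (fun _ : Fin 1 => a)⟩
  let x : M1 := ⟨1, Matrix.diagonal ![a, b]⟩
  have hyx : y ⤳ x := by
    have : 𝓝 y ≤ 𝓝 x := by
      refine le_of_le_of_eq ?_ (TopologicalSpace.nhds_generateFrom (a := x)
        (g := { U | ∃ (I J : ℕ) (δ : Matrix (Fin I) (Fin J) (Polynomial ℂ)), U = Bdelta1 δ })).symm
      refine le_iInf₂ fun U hU => ?_
      obtain ⟨hxU, I, J, δ, rfl⟩ := hU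
      rw [Filter.le_principal_iff]
      refine IsOpen.mem_nhds (TopologicalSpace.isOpen_generateFrom_of_mem ⟨I, J, δ, rfl⟩) ?_
      exact lt_of_le_of_lt (opNorm_compress δ a b) hxU
    exact this
  have hy : y ∈ {x : M1 | Polynomial.aeval x.2 p = 0} := by
    change Polynomial.aeval (Matrix.diagonal (fun _ : Fin 1 => a)) p = 0
    rw [aeval_diag, ha]
    simp
  have hx := hyx.mem_closed hc hy
  change Polynomial.aeval (Matrix.diagonal ![a, b]) p = 0 at hx
  rw [aeval_diag] at hx
  exact hb (by simpa using congrFun (congrFun hx 1) 1)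
end
end

section
/- Let d ≥ 1 and let p be a free polynomial in d noncommuting variables. The closure, in the free topology on M^d, of the set T = {x ∈ M^d : p(x) = 0} is contained in the set {x ∈ M^d : p(x) is singular}. -/
open Topology

noncomputable section

/-- `M^d`: the disjoint union over `n ≥ 1` of `d`-tuples of `n × n` complex matrices. -/
def Md (d : ℕ) : Type := Σ n : ℕ, Fin d → Matrix (Fin (n + 1)) (Fin (n + 1)) ℂ

/-- Evaluation of a free polynomial in `d` variables at a `d`-tuple of matrices. -/
noncomputable def evalFree {d n : ℕ} (x : Fin d → Matrix (Fin n) (Fin n) ℂ)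
    (p : FreeAlgebra ℂ (Fin d)) : Matrix (Fin n) (Fin n) ℂ :=
  FreeAlgebra.lift ℂ x p

/-- Block evaluation `δ(x)` of an `I × J` matrix of free polynomials at a `d`-tuple of
matrices. -/
noncomputable def evalDelta {d I J n : ℕ} (δ : Matrix (Fin I) (Fin J) (FreeAlgebra ℂ (Fin d)))
    (x : Fin d → Matrix (Fin n) (Fin n) ℂ) : Matrix (Fin I × Fin n) (Fin J × Fin n) ℂ :=
  Matrix.of fun p q => evalFree x (δ p.1 q.1) p.2 q.2

/-- The basic free open set `B_δ = {x ∈ M^d : ‖δ(x)‖ < 1}`. -/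
noncomputable def BdeltaD {d I J : ℕ} (δ : Matrix (Fin I) (Fin J) (FreeAlgebra ℂ (Fin d))) :
    Set (Md d) :=
  { x | opNorm (evalDelta δ x.2) < 1 }

/-- The free topology on `M^d`: the topology with the sets `B_δ` as a basis. -/
def freeTopology (d : ℕ) : TopologicalSpace (Md d) :=
  TopologicalSpace.generateFrom
    { U | ∃ (I J : ℕ) (δ : Matrix (Fin I) (Fin J) (FreeAlgebra ℂ (Fin d))), U = BdeltaD δ }

/-- Block-diagonal direct sum of two square complex matrices. -/
noncomputable def oplus {n m : ℕ} (a : Matrix (Fin n) (Fin n) ℂ)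
    (b : Matrix (Fin m) (Fin m) ℂ) : Matrix (Fin (n + m)) (Fin (n + m)) ℂ :=
  Matrix.reindex finSumFinEquiv finSumFinEquiv (Matrix.fromBlocks a 0 0 b)

/-- Componentwise block-diagonal direct sum on `M^d`. -/
noncomputable def dsum {d : ℕ} (x y : Md d) : Md d :=
  ⟨x.1 + 1 + y.1, fun j => oplus (n := x.1 + 1) (m := y.1 + 1) (x.2 j) (y.2 j)⟩

/-- For a free polynomial `p` in `d ≥ 1` noncommuting variables, the free closure of the
free variety `{x ∈ M^d : p(x) = 0}` is contained in `{x ∈ M^d : p(x) is singular}`. -/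
theorem free_closure_variety_subset_singular (d : ℕ) (hd : 1 ≤ d)
    (p : FreeAlgebra ℂ (Fin d)) :
    @closure _ (freeTopology d) {x : Md d | evalFree x.2 p = 0} ⊆
      {x : Md d | ¬ IsUnit (evalFree x.2 p)} := by
  intro x hx hu
  set A := evalFree x.2 p with hA
  have hdet : A.det ≠ 0 := ((Matrix.isUnit_iff_isUnit_det A).mp hu).ne_zero
  have hc : A.charpoly.coeff 0 ≠ 0 := by
    intro h
    apply hdet
    rw [Matrix.det_eq_sign_charpoly_coeff, h, mul_zero]
  set c := A.charpoly.coeff 0 with hcdef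
  let r : FreeAlgebra ℂ (Fin d) := c⁻¹ • Polynomial.aeval p A.charpoly
  have hev : ∀ y : Md d, evalFree y.2 r = c⁻¹ • Polynomial.aeval (evalFree y.2 p) A.charpoly := by
    intro y
    simp only [r, evalFree, map_smul]
    rw [Polynomial.aeval_algHom_apply]
  let δ : Matrix (Fin 1) (Fin 1) (FreeAlgebra ℂ (Fin d)) := fun _ _ => r
  have hopen : @IsOpen _ (freeTopology d) (BdeltaD δ) :=
    TopologicalSpace.isOpen_generateFrom_of_mem ⟨1, 1, δ, rfl⟩
  have hxr : evalFree x.2 r = 0 := by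
    rw [hev, ← hA, Matrix.aeval_self_charpoly, smul_zero]
  have hmem : x ∈ BdeltaD δ := by
    have h0 : evalDelta δ x.2 = 0 := by
      ext i j
      simp [evalDelta, δ, hxr]
    simp [BdeltaD, opNorm, h0]
  obtain ⟨y, hy, hyT⟩ := (@mem_closure_iff _ (freeTopology d) _ _).mp hx _ hopen hmem
  have hyT' : evalFree y.2 p = 0 := hyT
  have hyr : evalFree y.2 r = 1 := by
    rw [hev, hyT', ← Polynomial.coeff_zero_eq_aeval_zero', ← hcdef, Algebra.algebraMap_eq_smul_one,
      smul_smul, inv_mul_cancel₀ hc, one_smul]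
  have h1 : evalDelta δ y.2 = 1 := by
    ext ⟨i, i'⟩ ⟨j, j'⟩
    simp [evalDelta, δ, hyr, Matrix.one_apply, Subsingleton.elim i j]
  have hn : opNorm (evalDelta δ y.2) = 1 := by
    rw [h1, opNorm]
    have : LinearMap.toContinuousLinearMap (Matrix.toEuclideanLin
        (1 : Matrix (Fin 1 × Fin (y.1 + 1)) (Fin 1 × Fin (y.1 + 1)) ℂ)) =
        ContinuousLinearMap.id ℂ _ := by
      ext v i
      simp [Matrix.toEuclideanLin]
    rw [this]
    exact ContinuousLinearMap.norm_id
  have hlt : opNorm (evalDelta δ y.2) < 1 := hy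
  rw [hn] at hlt
  exact lt_irrefl _ hlt
end
end

section
/- Let x ∈ Mₙ(ℂ). The free square root √x = {y ∈ alg(x) : y² = x} is empty if and only if the Jordan canonical form of x contains a nilpotent Jordan cell of size k×k for some k ≥ 2; equivalently, √x = ∅ if and only if ker x ≠ ker x². -/
open Topology

noncomputable section

open Polynomial in
lemma exists_sqrt_mod (s : Multiset ℂ) : s.count 0 ≤ 1 →
    ∃ p : ℂ[X], (s.map (fun a => X - C a)).prod ∣ p ^ 2 - X := by
  induction s using Multiset.induction_on with
  | empty => intro _; exact ⟨0, by simp⟩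
  | cons a s ih =>
    intro h
    obtain ⟨p, r, hr⟩ := ih ((Multiset.count_le_count_cons 0 a s).trans h)
    set m := (s.map (fun a => X - C a)).prod with hm
    have key : ∃ t : ℂ, m.eval a * t ^ 2 + 2 * p.eval a * t + r.eval a = 0 := by
      by_cases hma : m.eval a = 0
      · have h1 := congrArg (eval a) hr
        simp only [eval_sub, eval_pow, eval_X, eval_mul, hma, zero_mul] at h1
        have hp : p.eval a ≠ 0 := by
          intro hp
          have ha : a = 0 := by rw [hp] at h1; simpa using h1
          subst ha
          have h0 : (0 : ℂ) ∈ s := by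
            rw [hm, eval_multiset_prod, Multiset.prod_eq_zero_iff] at hma
            simp only [Multiset.map_map, Multiset.mem_map, Function.comp, eval_sub, eval_X,
              eval_C] at hma
            obtain ⟨b, hb, hb'⟩ := hma
            have : b = 0 := by simpa using hb'
            rwa [this] at hb
          have := Multiset.count_pos.2 h0
          rw [Multiset.count_cons_self] at h
          omega
        refine ⟨-(r.eval a) / (2 * p.eval a), ?_⟩
        rw [hma]
        field_simp
        ring
      · obtain ⟨t, ht⟩ := IsAlgClosed.exists_root
          (C (m.eval a) * X ^ 2 + C (2 * p.eval a) * X + C (r.eval a))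
          (by rw [degree_quadratic hma]; decide)
        exact ⟨t, by simpa [IsRoot] using ht⟩
    obtain ⟨t, ht⟩ := key
    refine ⟨p + m * C t, ?_⟩
    have h2 : (X - C a) ∣ m * C t ^ 2 + 2 * p * C t + r := by
      rw [dvd_iff_isRoot]
      simpa [IsRoot] using ht
    obtain ⟨q, hq⟩ := h2
    rw [Multiset.map_cons, Multiset.prod_cons, ← hm]
    refine ⟨q, ?_⟩
    linear_combination hr + m * hq

open Polynomial in
/-- The free square root `√x = {y ∈ alg(x) : y² = x}` of a square complex matrix `x` is
empty if and only if `ker x ≠ ker x²` (equivalently, the Jordan canonical form of `x`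
contains a nilpotent Jordan cell of size `k × k` with `k ≥ 2`). -/
theorem freeSqrt_empty_iff {n : ℕ} (x : Matrix (Fin n) (Fin n) ℂ) :
    (¬ ∃ y ∈ Algebra.adjoin ℂ ({x} : Set (Matrix (Fin n) (Fin n) ℂ)), y ^ 2 = x) ↔
      LinearMap.ker x.mulVecLin ≠ LinearMap.ker (x ^ 2).mulVecLin := by
  rw [ne_eq, not_iff_not]
  constructor
  · rintro ⟨y, hy, hyx⟩
    ext v
    simp only [LinearMap.mem_ker, Matrix.mulVecLin_apply]
    constructor
    · intro h
      rw [pow_two, ← Matrix.mulVec_mulVec, h, Matrix.mulVec_zero]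
    · intro h
      rw [Algebra.adjoin_singleton_eq_range_aeval] at hy
      obtain ⟨p, hp⟩ := hy
      change aeval x p = y at hp
      have hpq := congrArg (aeval x) (divX_mul_X_add p)
      set c := p.coeff 0
      set q := aeval x p.divX with hq
      have hcx : q * x = x * q := by
        have := congrArg (aeval x) (mul_comm p.divX X)
        simpa using this
      have hyq : y = q * x + algebraMap ℂ _ c := by
        rw [← hp, ← hpq]; simp [hq]
      rw [Algebra.algebraMap_eq_smul_one] at hyq
      by_cases hc : c = 0
      · have hyq' : y = q * x := by rw [hyq, hc]; simp
        have hx2 : x = q * q * x ^ 2 := by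
          calc x = y * y := by rw [← pow_two, hyx]
            _ = q * (x * q) * x := by rw [hyq']; noncomm_ring
            _ = q * q * x ^ 2 := by rw [← hcx]; noncomm_ring
        rw [hx2, ← Matrix.mulVec_mulVec, h, Matrix.mulVec_zero]
      · have hx2 : (c ^ 2) • x = (1 - q * q * x - (2 * c) • q) * x ^ 2 := by
          have e : x = q * (x * q) * x + (2 * c) • (q * x) + (c ^ 2) • 1 := by
            calc x = y * y := by rw [← pow_two, hyx]
              _ = _ := by
                rw [hyq]
                simp only [add_mul, mul_add, smul_mul_assoc, mul_smul_comm, mul_one, one_mul,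
                  mul_assoc, smul_smul]
                module
          have e2 : x * x = (q * (x * q) * x + (2 * c) • (q * x) + (c ^ 2) • 1) * x :=
            congrArg (· * x) e
          rw [← hcx] at e2
          simp only [add_mul, sub_mul, smul_mul_assoc, one_mul, mul_assoc, pow_two x] at e2 ⊢
          rw [eq_sub_iff_add_eq, eq_sub_iff_add_eq]
          refine Eq.trans ?_ e2.symm
          abel
        have := congrArg (fun z => z.mulVec v) hx2
        simp only [← Matrix.mulVec_mulVec, h, Matrix.mulVec_zero, Matrix.smul_mulVec] at this
        exact (smul_eq_zero.1 this).resolve_left (pow_ne_zero 2 hc)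
  · intro hker
    have hint : IsIntegral ℂ x := Algebra.IsIntegral.isIntegral x
    have hm0 := minpoly.ne_zero hint
    have hcount : (minpoly ℂ x).roots.count 0 ≤ 1 := by
      by_contra hlt
      push Not at hlt
      rw [count_roots] at hlt
      have hd : (X : ℂ[X]) ^ 2 ∣ minpoly ℂ x := by
        have := (le_rootMultiplicity_iff hm0).1 (show 2 ≤ _ from hlt)
        simpa using this
      obtain ⟨g, hg⟩ := hd
      have h1 : x ^ 2 * aeval x g = 0 := by
        have := minpoly.aeval ℂ x
        rw [hg] at this
        simpa using this
      have h2 : x * aeval x g = 0 := by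
        refine Matrix.ext_of_mulVec_single fun i => ?_
        have : (aeval x g).mulVec (Pi.single i 1) ∈ LinearMap.ker (x ^ 2).mulVecLin := by
          rw [LinearMap.mem_ker, Matrix.mulVecLin_apply, Matrix.mulVec_mulVec, h1,
            Matrix.zero_mulVec]
        rw [← hker, LinearMap.mem_ker, Matrix.mulVecLin_apply, Matrix.mulVec_mulVec] at this
        rw [this, Matrix.zero_mulVec]
      have hdvd : minpoly ℂ x ∣ X * g := minpoly.dvd ℂ x (by simpa using h2)
      have hg0 : g ≠ 0 := by rintro rfl; simp at hg; exact hm0 hg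
      have hle := natDegree_le_of_dvd hdvd (mul_ne_zero X_ne_zero hg0)
      rw [hg, natDegree_mul (pow_ne_zero 2 X_ne_zero) hg0, natDegree_mul X_ne_zero hg0,
        natDegree_X_pow, natDegree_X] at hle
      omega
    obtain ⟨p, hp⟩ := exists_sqrt_mod _ hcount
    rw [← (IsAlgClosed.splits (minpoly ℂ x)).eq_prod_roots_of_monic (minpoly.monic hint)] at hp
    refine ⟨aeval x p, aeval_mem_adjoin_singleton ℂ x, ?_⟩
    have := (minpoly.dvd_iff).1 hp
    simpa [sub_eq_zero] using this
end
end

section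
/- Let M ∈ Mₙ(ℂ) be invertible and suppose that the spectrum σ(M) of M has exactly k elements. Then there exist exactly 2^k matrices N ∈ alg(M) satisfying N² = M; that is, the free square root √M has cardinality 2^k. -/
open Topology

noncomputable section

open Polynomial

theorem count_aux {A : Type*} [CommRing A] [Algebra ℂ A] (a : A) (σ : Finset ℂ)
    (h0 : (0:ℂ) ∉ σ) (hsurj : ∀ y : A, ∃ p : ℂ[X], aeval a p = y)
    (hnil : ∀ p : ℂ[X], IsNilpotent (aeval a p) ↔ ∀ μ ∈ σ, p.eval μ = 0) :
    Set.ncard {y : A | y ^ 2 = a} = 2 ^ σ.card := by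
  classical
  have hs : ∀ μ : ℂ, ∃ s : ℂ, s ^ 2 = μ := fun μ => IsAlgClosed.exists_pow_nat_eq μ (by norm_num)
  choose s hs using hs
  have hsne : ∀ μ ∈ σ, s μ ≠ 0 := by
    intro μ hμ h
    have := hs μ
    rw [h] at this
    apply h0
    have e : (0:ℂ) = μ := by simpa using this
    rwa [e]
  have hint : ∀ f : ℂ → ℂ, ∃ q : ℂ[X], ∀ μ ∈ σ, q.eval μ = f μ := fun f =>
    ⟨Lagrange.interpolate σ id f, fun μ hμ => by
      simpa using Lagrange.eval_interpolate_at_node f (Set.injOn_id _) hμ⟩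
  let f : Finset ℂ → ℂ → ℂ := fun T μ => if μ ∈ T then s μ else - s μ
  have hf2 : ∀ T μ, f T μ ^ 2 = μ := by
    intro T μ
    by_cases h : μ ∈ T <;> simp [f, h, hs]
  have hfne : ∀ T, ∀ μ ∈ σ, f T μ ≠ 0 := by
    intro T μ hμ
    by_cases h : μ ∈ T <;> simp [f, h, hsne μ hμ]
  choose q hq using fun T => hint (f T)
  have key : ∀ T, ∃! r, IsNilpotent (aeval a (q T) - r) ∧ aeval r (X ^ 2 - C a : A[X]) = 0 := by
    intro T
    apply existsUnique_nilpotent_sub_and_aeval_eq_zero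
    · have : IsNilpotent (aeval a ((q T) ^ 2 - X)) := by
        rw [hnil]
        intro μ hμ
        simp [hq T μ hμ, hf2]
      simpa using this
    · obtain ⟨u, hu⟩ := hint (fun μ => (2 * f T μ)⁻¹)
      have : IsNilpotent (aeval a ((1 + 1) * q T * u - 1)) := by
        rw [hnil]
        intro μ hμ
        have := hfne T μ hμ
        simp only [eval_sub, eval_mul, eval_add, eval_one, hq T μ hμ, hu μ hμ]
        field_simp
        norm_num
      have h1 := this.isUnit_one_add
      have h2 : IsUnit ((1 + 1) * aeval a (q T) * aeval a u) := by
        simpa only [map_sub, map_mul, map_add, map_one, add_sub_cancel] using h1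
      have h3 := isUnit_of_mul_isUnit_left h2
      simpa [derivative_X_pow] using h3
  choose r hr hr' using key
  have hr1 : ∀ T, IsNilpotent (aeval a (q T) - r T) := fun T => (hr T).1
  have hr2 : ∀ T, r T ^ 2 = a := fun T => by
    have := (hr T).2
    simpa [sub_eq_zero] using this
  have himg : {y : A | y ^ 2 = a} = (σ.powerset.image r : Finset A) := by
    ext y
    simp only [Set.mem_ofPred_eq, Finset.coe_image, Set.mem_image, Finset.mem_coe,
      Finset.mem_powerset]
    constructor
    · intro hy
      obtain ⟨p, rfl⟩ := hsurj y
      have hp : ∀ μ ∈ σ, (p ^ 2 - X).eval μ = 0 := by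
        rw [← hnil]
        simp [hy]
      refine ⟨σ.filter (fun μ => p.eval μ = s μ), Finset.filter_subset _ _, ?_⟩
      symm
      apply hr'
      refine ⟨?_, by simp [hy]⟩
      rw [← map_sub, hnil]
      intro μ hμ
      have h1 : (p.eval μ) ^ 2 = s μ ^ 2 := by
        have := hp μ hμ
        rw [hs]
        simpa [sub_eq_zero] using this
      rw [eval_sub, hq _ μ hμ]
      by_cases h : p.eval μ = s μ
      · simp [f, h, hμ]
      · have h3 := (sq_eq_sq_iff_eq_or_eq_neg.1 h1).resolve_left h
        simp only [f, Finset.mem_filter, hμ, h, and_false, if_false]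
        rw [h3, sub_self]
    · rintro ⟨T, -, rfl⟩
      exact hr2 T
  rw [himg, Set.ncard_coe_finset, Finset.card_image_of_injOn, Finset.card_powerset]
  intro T hT T' hT' h
  have hT : T ⊆ σ := by simpa using hT
  have hT' : T' ⊆ σ := by simpa using hT'
  have hn : IsNilpotent (aeval a (q T - q T')) := by
    have := Commute.isNilpotent_sub (Commute.all _ _) (hr1 T) (hr1 T')
    have h : r T = r T' := h
    rw [h] at this
    simpa using this
  rw [hnil] at hn
  have hn' : ∀ μ ∈ σ, (μ ∈ T ↔ μ ∈ T') := by
    intro μ hμ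
    have h1 := hn μ hμ
    have h2 := hsne μ hμ
    rw [eval_sub, hq T μ hμ, hq T' μ hμ, sub_eq_zero] at h1
    by_cases ha : μ ∈ T <;> by_cases hb : μ ∈ T' <;> simp [f, ha, hb] at h1 ⊢
    · exact h2 (self_eq_neg.1 h1)
    · exact h2 (self_eq_neg.1 h1.symm)
  ext μ
  exact ⟨fun h => (hn' μ (hT h)).1 h, fun h => (hn' μ (hT' h)).2 h⟩

theorem nil_aux {n : ℕ} (M : Matrix (Fin n) (Fin n) ℂ) (p : ℂ[X]) :
    IsNilpotent (aeval M p) ↔ ∀ μ ∈ spectrum ℂ M, p.eval μ = 0 := by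
  constructor
  · rintro ⟨m, hm⟩ μ hμ
    have h1 : (p ^ m).eval μ ∈ spectrum ℂ (aeval M (p ^ m)) :=
      spectrum.subset_polynomial_aeval M (p ^ m) ⟨μ, hμ, rfl⟩
    rw [map_pow, hm] at h1
    have : Nontrivial (Matrix (Fin n) (Fin n) ℂ) := by
      by_contra hc
      rw [not_nontrivial_iff_subsingleton] at hc
      rw [spectrum.of_subsingleton] at hμ
      exact hμ
    rw [spectrum.zero_eq] at h1
    have : (p.eval μ) ^ m = 0 := by simpa using h1
    exact eq_zero_of_pow_eq_zero this
  · intro h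
    have hd : M.charpoly ∣ p ^ M.charpoly.roots.card := by
      have hp := (IsAlgClosed.splits M.charpoly).eq_prod_roots_of_monic M.charpoly_monic
      rw [← Multiset.prod_replicate, ← Multiset.map_const']
      refine hp.dvd.trans ?_
      refine Multiset.prod_dvd_prod_of_dvd _ _ ?_
      intro μ hμ
      rw [dvd_iff_isRoot]
      apply h
      rw [Matrix.mem_spectrum_iff_isRoot_charpoly]
      exact isRoot_of_mem_roots hμ
    obtain ⟨c, hc⟩ := hd
    refine ⟨M.charpoly.roots.card, ?_⟩
    rw [← map_pow, hc, map_mul, Matrix.aeval_self_charpoly, zero_mul]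

theorem ncard_freeSqrt_of_invertible {n k : ℕ} (M : Matrix (Fin n) (Fin n) ℂ)
    (hM : IsUnit M) (hk : (spectrum ℂ M).ncard = k) :
    Set.ncard {y : Matrix (Fin n) (Fin n) ℂ |
      y ∈ Algebra.adjoin ℂ ({M} : Set (Matrix (Fin n) (Fin n) ℂ)) ∧ y ^ 2 = M} = 2 ^ k := by
  have hfin : (spectrum ℂ M).Finite := by
    refine (M.charpoly.roots.toFinset.finite_toSet).subset ?_
    intro μ hμ
    rw [Matrix.mem_spectrum_iff_isRoot_charpoly] at hμ
    simpa [M.charpoly_monic.ne_zero] using hμ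
  let A := Algebra.adjoin ℂ ({M} : Set (Matrix (Fin n) (Fin n) ℂ))
  let : CommRing A := { (inferInstance : Ring A) with
    mul_comm := by
      rintro ⟨x, hx⟩ ⟨y, hy⟩
      apply Subtype.ext
      simp only [A, Algebra.adjoin_singleton_eq_range_aeval] at hx hy
      obtain ⟨p, rfl⟩ := hx
      obtain ⟨q, rfl⟩ := hy
      change aeval M p * aeval M q = aeval M q * aeval M p
      rw [← map_mul, mul_comm, map_mul] }
  let : Algebra ℂ A := Subalgebra.algebra A
  let a : A := ⟨M, Algebra.self_mem_adjoin_singleton ℂ M⟩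
  let v : A →ₐ[ℂ] Matrix (Fin n) (Fin n) ℂ := A.val
  have hv : Function.Injective v := Subtype.val_injective
  have hva : ∀ p : ℂ[X], v (aeval a p) = aeval M p := by
    intro p
    rw [← aeval_algHom_apply]
    rfl
  have hmain := count_aux a hfin.toFinset
    (by simpa using spectrum.zero_notMem ℂ hM)
    (by
      rintro ⟨y, hy⟩
      have hy' := hy
      simp only [A, Algebra.adjoin_singleton_eq_range_aeval] at hy'
      obtain ⟨p, hp⟩ := hy'
      refine ⟨p, hv ?_⟩
      rw [hva]
      exact hp)
    (by
      intro p
      rw [← IsNilpotent.map_iff hv, hva, nil_aux]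
      simp)
  rw [← Set.ncard_eq_toFinset_card _ hfin, hk] at hmain
  rw [← hmain, ← Set.ncard_image_of_injective _ hv]
  congr 1
  ext y
  simp only [Set.mem_ofPred_eq, Set.mem_image]
  constructor
  · rintro ⟨h1, h2⟩
    exact ⟨⟨y, h1⟩, hv (by rw [map_pow]; exact h2), rfl⟩
  · rintro ⟨z, hz, rfl⟩
    refine ⟨z.2, ?_⟩
    rw [← map_pow, hz]
    rfl
end
end

section
/- Let k ≥ 1, let c ∈ ℂᵏ and r ∈ (0,∞)ᵏ be such that the open discs c_j + r_j𝔻 (j = 1,…,k) are pairwise disjoint, and let Δ(c,r) = ⋃_{j=1}^k (c_j + r_j𝔻). Then the set D(c,r) = {x ∈ M¹ : σ(x) ⊆ Δ(c,r)} is open in the free topology on M¹. -/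
open Topology

noncomputable section

/-- Values of `p` on the spectrum of `y` are bounded by the norm of the block evaluation. -/
theorem norm_eval_le_opNorm {n : ℕ} (p : Polynomial ℂ) (y : Matrix (Fin n) (Fin n) ℂ) (l : ℂ)
    (hl : l ∈ spectrum ℂ y) :
    ‖p.eval l‖ ≤ opNorm (evalDelta1 (Matrix.of fun (_ : Fin 1) (_ : Fin 1) => p) y) := by
  have h1 : p.eval l ∈ spectrum ℂ (Polynomial.aeval y p) :=
    spectrum.subset_polynomial_aeval y p ⟨l, hl, rfl⟩
  rw [← Matrix.spectrum_toLin', ← Module.End.hasEigenvalue_iff_mem_spectrum] at h1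
  obtain ⟨v, hv⟩ := h1.exists_hasEigenvector
  have hv1 := hv.apply_eq_smul
  rw [Matrix.toLin'_apply] at hv1
  let w : EuclideanSpace ℂ (Fin 1 × Fin n) := WithLp.toLp 2 fun q => v q.2
  have hw : w ≠ 0 := by
    intro h
    apply hv.2
    funext i
    have := congrArg (fun u : EuclideanSpace ℂ (Fin 1 × Fin n) => u (0, i)) h
    simpa [w] using this
  have hA : (LinearMap.toContinuousLinearMap (Matrix.toEuclideanLin
      (evalDelta1 (Matrix.of fun (_ : Fin 1) (_ : Fin 1) => p) y))) w = p.eval l • w := by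
    ext ⟨a, i⟩
    have := congrFun hv1 i
    simpa [w, Matrix.toLpLin_apply, Matrix.mulVec, dotProduct, evalDelta1,
      Fintype.sum_prod_type] using this
  have h2 := ContinuousLinearMap.le_opNorm (LinearMap.toContinuousLinearMap (Matrix.toEuclideanLin
      (evalDelta1 (Matrix.of fun (_ : Fin 1) (_ : Fin 1) => p) y))) w
  rw [hA, norm_smul] at h2
  exact le_of_mul_le_mul_right h2 (norm_pos_iff.mpr hw)

/-- A product over a multiset of complex numbers of norm at least `d`. -/
theorem pow_card_le_norm_prod (s : Multiset ℂ) (d : ℝ) (hd : 0 ≤ d) (h : ∀ a ∈ s, d ≤ ‖a‖) :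
    d ^ s.card ≤ ‖s.prod‖ := by
  induction s using Multiset.induction_on with
  | empty => simp
  | cons a s ih =>
    rw [Multiset.card_cons, Multiset.prod_cons, norm_mul, pow_succ, mul_comm]
    have h1 := ih fun b hb => h b (Multiset.mem_cons_of_mem hb)
    have h2 := h a (Multiset.mem_cons_self a s)
    gcongr

/-- For pairwise disjoint open discs `cⱼ + rⱼ·𝔻` (`j = 1, …, k`, `k ≥ 1`), the set
`D(c,r) = {x ∈ M¹ : σ(x) ⊆ Δ(c,r)}` is open in the free topology on `M¹`. -/
theorem D_c_r_freely_open (k : ℕ) (hk : 1 ≤ k) (c : Fin k → ℂ) (r : Fin k → ℝ)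
    (hr : ∀ j, 0 < r j)
    (hdisj : ∀ i j, i ≠ j → Disjoint (Metric.ball (c i) (r i)) (Metric.ball (c j) (r j))) :
    IsOpen {x : M1 | spectrum ℂ x.2 ⊆ ⋃ j, Metric.ball (c j) (r j)} := by
  rw [isOpen_iff_forall_mem_open]
  rintro ⟨n, x⟩ hx
  have hU : IsOpen (⋃ j, Metric.ball (c j) (r j)) := isOpen_iUnion fun j => Metric.isOpen_ball
  have hK : IsCompact (spectrum ℂ x) := (Matrix.finite_spectrum x).isCompact
  obtain ⟨d, hd, hdU⟩ := hK.exists_thickening_subset_open hU hx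
  have hdn : (0 : ℝ) < d ^ x.charpoly.roots.card := pow_pos hd _
  let p : Polynomial ℂ := Polynomial.C (((d ^ x.charpoly.roots.card : ℝ) : ℂ)⁻¹) * x.charpoly
  refine ⟨Bdelta1 (Matrix.of fun (_ : Fin 1) (_ : Fin 1) => p), ?_, ?_, ?_⟩
  · rintro ⟨m, y⟩ hy l hl
    have h1 : ‖p.eval l‖ < 1 := (norm_eval_le_opNorm p y l hl).trans_lt hy
    by_contra hlU
    have hprod : x.charpoly.eval l = (x.charpoly.roots.map fun a => l - a).prod :=
      (IsAlgClosed.splits x.charpoly).eval_eq_prod_roots_of_monic (Matrix.charpoly_monic x) l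
    have h2 : d ^ x.charpoly.roots.card ≤ ‖x.charpoly.eval l‖ := by
      rw [hprod]
      have := pow_card_le_norm_prod (x.charpoly.roots.map fun a => l - a) d hd.le (by
        intro b hb
        obtain ⟨a, ha, rfl⟩ := Multiset.mem_map.mp hb
        by_contra hlt
        push Not at hlt
        apply hlU
        apply hdU
        rw [Metric.mem_thickening_iff]
        refine ⟨a, ?_, by rwa [dist_eq_norm]⟩
        exact Matrix.mem_spectrum_iff_isRoot_charpoly.mpr (Polynomial.isRoot_of_mem_roots ha))
      simpa using this
    have h3 : ‖p.eval l‖ = (d ^ x.charpoly.roots.card)⁻¹ * ‖x.charpoly.eval l‖ := by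
      simp only [p, Polynomial.eval_mul, Polynomial.eval_C, norm_mul, norm_inv,
        Complex.norm_real, Real.norm_of_nonneg hdn.le]
    rw [h3, inv_mul_lt_iff₀ hdn, mul_one] at h1
    exact absurd h1 (not_lt.mpr h2)
  · exact TopologicalSpace.isOpen_generateFrom_of_mem ⟨1, 1, _, rfl⟩
  · have h0 : Polynomial.aeval x p = 0 := by
      simp [p, Matrix.aeval_self_charpoly]
    have h1 : evalDelta1 (Matrix.of fun (_ : Fin 1) (_ : Fin 1) => p) x = 0 := by
      ext a b
      simp [evalDelta1, h0]
    change opNorm (evalDelta1 (Matrix.of fun (_ : Fin 1) (_ : Fin 1) => p) x) < 1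
    rw [h1]
    simp [opNorm]
end
end

section
/- Let δ = (δ_{ij}) be an I×J matrix of polynomials in ℂ[X], let M ∈ Mₙ(ℂ), and let λ ∈ ℂ be an eigenvalue of M. Then the operator norm of the I×J scalar matrix δ(λ) = (δ_{ij}(λ)) is at most the operator norm of the In×Jn block matrix δ(M) = (δ_{ij}(M)). -/
open Topology

noncomputable section

/-- A matrix polynomial acts on an eigenvector by the evaluated scalar. -/
theorem aux_aeval_mulVec {n : ℕ} (M : Matrix (Fin n) (Fin n) ℂ) (lam : ℂ) (v : Fin n → ℂ)
    (hv : M.mulVec v = lam • v) (p : Polynomial ℂ) :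
    (Polynomial.aeval M p).mulVec v = p.eval lam • v := by
  induction p using Polynomial.induction_on' with
  | add p q hp hq => simp [Matrix.add_mulVec, hp, hq, add_smul]
  | monomial k a =>
    have hk : ∀ k : ℕ, (M ^ k).mulVec v = lam ^ k • v := by
      intro k
      induction k with
      | zero => simp
      | succ k ih =>
        rw [pow_succ, ← Matrix.mulVec_mulVec, hv, Matrix.mulVec_smul, ih, smul_smul, pow_succ,
          mul_comm]
    rw [Polynomial.aeval_monomial, Polynomial.eval_monomial, ← Algebra.smul_def,
      Matrix.smul_mulVec, hk, smul_smul]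

theorem aux_norm_tensor {a b : Type*} [Fintype a] [Fintype b] (w : a → ℂ) (v : b → ℂ) :
    ‖(WithLp.toLp 2 (fun q : a × b => w q.1 * v q.2) : EuclideanSpace ℂ (a × b))‖ =
      ‖(WithLp.toLp 2 w : EuclideanSpace ℂ a)‖ * ‖(WithLp.toLp 2 v : EuclideanSpace ℂ b)‖ := by
  rw [EuclideanSpace.norm_eq, EuclideanSpace.norm_eq, EuclideanSpace.norm_eq,
    ← Real.sqrt_mul (by positivity)]
  congr 1
  simp only [norm_mul, mul_pow, Fintype.sum_prod_type, Finset.sum_mul_sum]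

/-- If `λ` is an eigenvalue of `M`, then `‖δ(λ)‖ ≤ ‖δ(M)‖` for any matrix `δ` of
polynomials. -/
theorem opNorm_eval_scalar_le {I J n : ℕ} (δ : Matrix (Fin I) (Fin J) (Polynomial ℂ))
    (M : Matrix (Fin n) (Fin n) ℂ) (lam : ℂ) (hlam : lam ∈ spectrum ℂ M) :
    opNorm (Matrix.of fun i j => (δ i j).eval lam) ≤ opNorm (evalDelta1 δ M) := by
  classical
  obtain ⟨v, hv0, hv⟩ : ∃ v : Fin n → ℂ, v ≠ 0 ∧ M.mulVec v = lam • v := by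
    rw [← Matrix.spectrum_toLin', ← Module.End.hasEigenvalue_iff_mem_spectrum] at hlam
    obtain ⟨v, hv⟩ := hlam.exists_hasEigenvector
    exact ⟨v, hv.2, by simpa using hv.apply_eq_smul⟩
  have hvpos : 0 < ‖(WithLp.toLp 2 v : EuclideanSpace ℂ (Fin n))‖ := by
    rw [norm_pos_iff]
    simpa using hv0
  unfold opNorm
  refine ContinuousLinearMap.opNorm_le_bound _ (norm_nonneg _) fun w => ?_
  obtain ⟨w⟩ := w
  have key := ContinuousLinearMap.le_opNorm
    (LinearMap.toContinuousLinearMap (Matrix.toEuclideanLin (evalDelta1 δ M)))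
    (WithLp.toLp 2 (fun q : Fin J × Fin n => w q.1 * v q.2))
  have heq : (evalDelta1 δ M).mulVec (fun q : Fin J × Fin n => w q.1 * v q.2) =
      fun p : Fin I × Fin n =>
        ((Matrix.of fun i j => (δ i j).eval lam : Matrix (Fin I) (Fin J) ℂ).mulVec w) p.1
          * v p.2 := by
    funext p
    simp only [Matrix.mulVec, dotProduct, evalDelta1, Matrix.of_apply, Fintype.sum_prod_type,
      Finset.sum_mul]
    refine Finset.sum_congr rfl fun j _ => ?_
    have h := congrFun (aux_aeval_mulVec M lam v hv (δ p.1 j)) p.2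
    simp only [Matrix.mulVec, dotProduct, Pi.smul_apply, smul_eq_mul] at h
    rw [mul_right_comm, ← h, Finset.sum_mul]
    exact Finset.sum_congr rfl fun k _ => by ring
  rw [LinearMap.coe_toContinuousLinearMap', Matrix.toLpLin_toLp, Matrix.toLin'_apply, heq, aux_norm_tensor,
    aux_norm_tensor, ← mul_assoc] at key
  rw [LinearMap.coe_toContinuousLinearMap', Matrix.toLpLin_toLp, Matrix.toLin'_apply]
  exact le_of_mul_le_mul_right key hvpos
end
end

section
/- Let n ≥ 1, let w₁ = (w₁¹, w₁²) and w₂ = (w₂¹, w₂²) be pairs of n×n complex matrices, and let s be an invertible n×n complex matrix. Suppose that π(w₁) = s⁻¹ π(w₂) s (componentwise, i.e. u₁ = s⁻¹u₂s, v₁² = s⁻¹v₂²s, and v₁u₁v₁ = s⁻¹v₂u₂v₂s) and that w₁¹ − w₁² is invertible. Then for every symmetric free polynomial p ∈ ℂ⟨x,y⟩ one has p(w₁) = s⁻¹ p(w₂) s, where p(w) denotes the image of p under the unital algebra homomorphism ℂ⟨x,y⟩ → Mₙ(ℂ) sending x to w¹ and y to w². -/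
open Topology

noncomputable section

/-- `u = ½(w¹ + w²)` for a pair of square matrices. -/
noncomputable def uOf {n : ℕ} (w : Matrix (Fin n) (Fin n) ℂ × Matrix (Fin n) (Fin n) ℂ) :
    Matrix (Fin n) (Fin n) ℂ := (1/2 : ℂ) • (w.1 + w.2)

/-- `v = ½(w¹ - w²)` for a pair of square matrices. -/
noncomputable def vOf {n : ℕ} (w : Matrix (Fin n) (Fin n) ℂ × Matrix (Fin n) (Fin n) ℂ) :
    Matrix (Fin n) (Fin n) ℂ := (1/2 : ℂ) • (w.1 - w.2)

/-- The map `π(w) = (u, v², vuv)`. -/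
noncomputable def piMap {n : ℕ} (w : Matrix (Fin n) (Fin n) ℂ × Matrix (Fin n) (Fin n) ℂ) :
    Matrix (Fin n) (Fin n) ℂ × Matrix (Fin n) (Fin n) ℂ × Matrix (Fin n) (Fin n) ℂ :=
  (uOf w, vOf w * vOf w, vOf w * uOf w * vOf w)

/-- The automorphism of the free algebra `ℂ⟨x,y⟩` (on the index set `Bool`) interchanging
the two generators. -/
noncomputable def swapFA : FreeAlgebra ℂ Bool →ₐ[ℂ] FreeAlgebra ℂ Bool :=
  FreeAlgebra.lift ℂ (fun b => FreeAlgebra.ι ℂ (!b))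

/-- Evaluation of a free polynomial `p ∈ ℂ⟨x,y⟩` at a pair of square matrices, sending
`x` to `w¹` and `y` to `w²`. -/
noncomputable def evalPair {n : ℕ} (w : Matrix (Fin n) (Fin n) ℂ × Matrix (Fin n) (Fin n) ℂ)
    (p : FreeAlgebra ℂ Bool) : Matrix (Fin n) (Fin n) ℂ :=
  FreeAlgebra.lift ℂ (fun b => if b then w.2 else w.1) p

/-- Key decomposition, by induction on the free polynomial. -/
theorem key_decomp {M : Type*} [Ring M] [Algebra ℂ M] (a b : Mˣ) (u : M) (V : M)
    (haV : (a : M) * a = V) (hbV : (b : M) * b = V)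
    (hau : (a : M) * u * a = b * u * b)
    (p : FreeAlgebra ℂ Bool) :
    ∃ X Y : M, (a : M) * X * (↑a⁻¹ : M) = b * X * (↑b⁻¹ : M) ∧
      (a : M) * Y * (↑a⁻¹ : M) = b * Y * (↑b⁻¹ : M) ∧
      FreeAlgebra.lift ℂ (fun t => if t then u - (a : M) else u + a) p = X + Y * a ∧
      FreeAlgebra.lift ℂ (fun t => if t then u - (a : M) else u + a) (swapFA p) = X - Y * a ∧
      FreeAlgebra.lift ℂ (fun t => if t then u - (b : M) else u + b) p = X + Y * b := by
  have hab2 : a * a = b * b := by ext; simp [haV, hbV]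
  have hi2 : a⁻¹ * a⁻¹ = b⁻¹ * b⁻¹ := by
    rw [← mul_inv_rev, ← mul_inv_rev, hab2]
  have hi2' : (↑a⁻¹ : M) * ↑a⁻¹ = ↑b⁻¹ * ↑b⁻¹ := by exact_mod_cast congrArg Units.val hi2
  have hab2' : (a : M) * a = b * b := by rw [haV, hbV]
  have hu' : (a : M) * u * (↑a⁻¹ : M) = b * u * (↑b⁻¹ : M) := by
    have h1 : (a : M) * u * (↑a⁻¹ : M) = (a * u * a) * (↑a⁻¹ * ↑a⁻¹) := by
      simp [mul_assoc]
    have h2 : (b : M) * u * (↑b⁻¹ : M) = (b * u * b) * (↑b⁻¹ * ↑b⁻¹) := by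
      simp [mul_assoc]
    rw [h1, h2, hau, hi2']
  have hsmul : ∀ X Y : M, (a : M) * X * (↑a⁻¹ : M) = b * X * (↑b⁻¹ : M) →
      (a : M) * Y * (↑a⁻¹ : M) = b * Y * (↑b⁻¹ : M) →
      (a : M) * (X * Y) * (↑a⁻¹ : M) = b * (X * Y) * (↑b⁻¹ : M) := by
    intro X Y hX hY
    have h1 : (a : M) * (X * Y) * (↑a⁻¹ : M) = (a * X * ↑a⁻¹) * (a * Y * ↑a⁻¹) := by
      simp [mul_assoc]
    have h2 : (b : M) * (X * Y) * (↑b⁻¹ : M) = (b * X * ↑b⁻¹) * (b * Y * ↑b⁻¹) := by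
      simp [mul_assoc]
    rw [h1, h2, hX, hY]
  have hsadd : ∀ X Y : M, (a : M) * X * (↑a⁻¹ : M) = b * X * (↑b⁻¹ : M) →
      (a : M) * Y * (↑a⁻¹ : M) = b * Y * (↑b⁻¹ : M) →
      (a : M) * (X + Y) * (↑a⁻¹ : M) = b * (X + Y) * (↑b⁻¹ : M) := by
    intro X Y hX hY
    simp only [mul_add, add_mul, hX, hY]
  have hV' : (a : M) * V * (↑a⁻¹ : M) = b * V * (↑b⁻¹ : M) := by
    have h1 : (a : M) * V * (↑a⁻¹ : M) = V := by rw [← haV]; simp [mul_assoc]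
    have h2 : (b : M) * V * (↑b⁻¹ : M) = V := by rw [← hbV]; simp [mul_assoc]
    rw [h1, h2]
  have hconj : ∀ X : M, (a : M) * X * (↑a⁻¹ : M) = b * X * (↑b⁻¹ : M) →
      (a : M) * (a * X * (↑a⁻¹ : M)) * (↑a⁻¹ : M)
        = b * (a * X * (↑a⁻¹ : M)) * (↑b⁻¹ : M) := by
    intro X hX
    have h1 : (a : M) * (a * X * (↑a⁻¹ : M)) * (↑a⁻¹ : M)
        = (a * a) * X * (↑a⁻¹ * ↑a⁻¹) := by simp only [mul_assoc]
    rw [h1, hX, hab2', hi2']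
    simp only [mul_assoc]
  induction p using FreeAlgebra.induction with
  | grade0 r =>
    refine ⟨algebraMap ℂ M r, 0, ?_, by simp, by simp, by simp, by simp⟩
    rw [← Algebra.commutes, ← Algebra.commutes r (b : M)]
    simp [mul_assoc]
  | grade1 t =>
    cases t
    · refine ⟨u, 1, hu', by simp, by simp, by simp [swapFA], by simp⟩
    · refine ⟨u, -1, hu', by simp, ?_, ?_, ?_⟩ <;> simp [swapFA, sub_eq_add_neg]
  | add p q hp hq =>
    obtain ⟨X, Y, hX, hY, h1, h2, h3⟩ := hp
    obtain ⟨X', Y', hX', hY', h1', h2', h3'⟩ := hq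
    refine ⟨X + X', Y + Y', hsadd _ _ hX hX', hsadd _ _ hY hY', ?_, ?_, ?_⟩
    · rw [map_add, h1, h1']; noncomm_ring
    · rw [map_add, map_add, h2, h2']; noncomm_ring
    · rw [map_add, h3, h3']; noncomm_ring
  | mul p q hp hq =>
    obtain ⟨X, Y, hX, hY, h1, h2, h3⟩ := hp
    obtain ⟨X', Y', hX', hY', h1', h2', h3'⟩ := hq
    have ca : ∀ Z : M, (a : M) * Z = (a * Z * (↑a⁻¹ : M)) * a := by
      intro Z; simp [mul_assoc]
    have cb : ∀ Z : M, (a : M) * Z * (↑a⁻¹ : M) = b * Z * (↑b⁻¹ : M) →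
        (b : M) * Z = (a * Z * (↑a⁻¹ : M)) * b := by
      intro Z hZ; rw [hZ]; simp [mul_assoc]
    refine ⟨X * X' + Y * (a * Y' * (↑a⁻¹ : M)) * V, X * Y' + Y * (a * X' * (↑a⁻¹ : M)),
      hsadd _ _ (hsmul _ _ hX hX') (hsmul _ _ (hsmul _ _ hY (hconj _ hY')) hV'),
      hsadd _ _ (hsmul _ _ hX hY') (hsmul _ _ hY (hconj _ hX')), ?_, ?_, ?_⟩
    · have e : (X + Y * a) * (X' + Y' * a)
          = X * X' + X * Y' * a + Y * (a * X') + Y * (a * Y') * a := by noncomm_ring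
      rw [ca X', ca Y'] at e
      rw [map_mul, h1, h1', e, ← haV]
      generalize (a : M) * X' * (↑a⁻¹ : M) = Z
      generalize (a : M) * Y' * (↑a⁻¹ : M) = W
      noncomm_ring
    · have e : (X - Y * a) * (X' - Y' * a)
          = X * X' - X * Y' * a - Y * (a * X') + Y * (a * Y') * a := by noncomm_ring
      rw [ca X', ca Y'] at e
      rw [map_mul, map_mul, h2, h2', e, ← haV]
      generalize (a : M) * X' * (↑a⁻¹ : M) = Z
      generalize (a : M) * Y' * (↑a⁻¹ : M) = W
      noncomm_ring
    · have e : (X + Y * b) * (X' + Y' * b)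
          = X * X' + X * Y' * b + Y * (b * X') + Y * (b * Y') * b := by noncomm_ring
      rw [map_mul, h3, h3', e, cb X' hX', cb Y' hY', ← hbV]
      generalize (a : M) * X' * (↑a⁻¹ : M) = Z
      generalize (a : M) * Y' * (↑a⁻¹ : M) = W
      noncomm_ring

/-- Evaluation commutes with conjugation. -/
theorem conj_eval {M : Type*} [Ring M] [Algebra ℂ M] (s t : M) (hst : s * t = 1)
    (hts : t * s = 1) (f g : Bool → M) (hfg : ∀ i, g i = t * f i * s)
    (p : FreeAlgebra ℂ Bool) :
    t * FreeAlgebra.lift ℂ f p * s = FreeAlgebra.lift ℂ g p := by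
  induction p using FreeAlgebra.induction with
  | grade0 r =>
    rw [AlgHom.commutes, AlgHom.commutes, ← Algebra.commutes, mul_assoc, hts, mul_one]
  | grade1 i => simp [hfg]
  | add p q hp hq => rw [map_add, map_add, mul_add, add_mul, hp, hq]
  | mul p q hp hq =>
    rw [map_mul, map_mul, ← hp, ← hq]
    have : ∀ A B : M, (t * A * s) * (t * B * s) = t * A * (s * t) * B * s := by
      intro A B; simp only [mul_assoc]
    rw [this, hst]; simp only [mul_assoc, one_mul]

/-- If `π(w₁) = s⁻¹ π(w₂) s` componentwise and `w₁¹ - w₁²` is invertible, then every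
symmetric free polynomial satisfies `p(w₁) = s⁻¹ p(w₂) s`. -/
theorem symmetric_poly_similar {n : ℕ} (hn : 1 ≤ n)
    (w₁ w₂ : Matrix (Fin n) (Fin n) ℂ × Matrix (Fin n) (Fin n) ℂ)
    (s : Matrix (Fin n) (Fin n) ℂ) (hs : IsUnit s)
    (hu : uOf w₁ = s⁻¹ * uOf w₂ * s)
    (hv2 : vOf w₁ * vOf w₁ = s⁻¹ * (vOf w₂ * vOf w₂) * s)
    (hvuv : vOf w₁ * uOf w₁ * vOf w₁ = s⁻¹ * (vOf w₂ * uOf w₂ * vOf w₂) * s)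
    (hinv : IsUnit (w₁.1 - w₁.2)) :
    ∀ p : FreeAlgebra ℂ Bool, swapFA p = p →
      evalPair w₁ p = s⁻¹ * evalPair w₂ p * s := by
  intro p hp
  have hdet : IsUnit s.det := (Matrix.isUnit_iff_isUnit_det s).1 hs
  have hst : s * s⁻¹ = 1 := Matrix.mul_nonsing_inv s hdet
  have hts : s⁻¹ * s = 1 := Matrix.nonsing_inv_mul s hdet
  have hcm : ∀ A B : Matrix (Fin n) (Fin n) ℂ,
      (s⁻¹ * A * s) * (s⁻¹ * B * s) = s⁻¹ * (A * B) * s := by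
    intro A B
    have : (s⁻¹ * A * s) * (s⁻¹ * B * s) = s⁻¹ * A * (s * s⁻¹) * B * s := by
      simp only [mul_assoc]
    rw [this, hst]; simp only [mul_assoc, one_mul]
  have hva : IsUnit (vOf w₁) := by
    have : vOf w₁ = (algebraMap ℂ (Matrix (Fin n) (Fin n) ℂ) (1/2)) * (w₁.1 - w₁.2) := by
      rw [vOf, Algebra.smul_def]
    rw [this]
    exact ((IsUnit.mk0 (1/2 : ℂ) (by norm_num)).map _).mul hinv
  have hbb : (s⁻¹ * vOf w₂ * s) * (s⁻¹ * vOf w₂ * s) = vOf w₁ * vOf w₁ := by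
    rw [hcm, hv2]
  have hvb : IsUnit (s⁻¹ * vOf w₂ * s) := by
    have h := hva.mul hva
    rw [← hbb] at h
    rw [Matrix.isUnit_iff_isUnit_det] at h ⊢
    rw [Matrix.det_mul] at h
    exact isUnit_of_mul_isUnit_left h
  obtain ⟨a, ha⟩ := hva
  obtain ⟨b, hb⟩ := hvb
  obtain ⟨X, Y, -, -, h1, h2, h3⟩ := key_decomp a b (uOf w₁) (vOf w₁ * vOf w₁)
    (by rw [ha]) (by rw [hb, hbb])
    (by rw [ha, hb, hvuv, hu, hcm, hcm]) p
  have huv : ∀ w : Matrix (Fin n) (Fin n) ℂ × Matrix (Fin n) (Fin n) ℂ,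
      uOf w + vOf w = w.1 ∧ uOf w - vOf w = w.2 := by
    intro w
    constructor <;> (simp only [uOf, vOf]; module)
  have e1 : evalPair w₁ p = X + Y * a := by
    rw [← h1, ha, (huv w₁).1, (huv w₁).2]; rfl
  have e2 : s⁻¹ * evalPair w₂ p * s = X + Y * b := by
    rw [← h3]
    unfold evalPair
    apply conj_eval s s⁻¹ hst hts
    intro i
    cases i
    · simp only [Bool.false_eq_true, if_false, hb, hu]
      rw [← (huv w₂).1]; noncomm_ring
    · simp only [if_true, hb, hu]
      rw [← (huv w₂).2]; noncomm_ring
  have hY : Y = 0 := by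
    rw [hp, h1] at h2
    have h4 : (2 : ℂ) • (Y * (a : Matrix (Fin n) (Fin n) ℂ)) = 0 := by
      have : (2 : ℂ) • (Y * (a : Matrix (Fin n) (Fin n) ℂ)) = (X + Y * a) - (X - Y * a) := by
        module
      rw [this, h2, sub_self]
    have h5 := (smul_eq_zero.1 h4).resolve_left (by norm_num)
    simpa using h5
  rw [e1, e2, hY]; simp
end
end

section
/- For every n ≥ 1, the set of pairs w = (w¹, w²) of n×n complex matrices such that w ≠ wᶠ and the only pairs w' of n×n complex matrices with π(w') = π(w) are w and wᶠ (so that π⁻¹(π(w)) has cardinality exactly 2) is dense in Mₙ(ℂ)² with its Euclidean topology. -/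
open Topology

noncomputable section

/-- The linear system satisfied by every `X` with `X² = v²`, `XuX = vuv`, plus one coordinate. -/
def sysMap {n : ℕ} (i₀ : Fin n) (u v : Matrix (Fin n) (Fin n) ℂ) :
    Matrix (Fin n) (Fin n) ℂ →ₗ[ℂ]
      Matrix (Fin n) (Fin n) ℂ × Matrix (Fin n) (Fin n) ℂ × ℂ where
  toFun X := (X * (v * v) - (v * v) * X, (v * v * u) * X - X * (v * u * v), X i₀ i₀)
  map_add' X Y := by
    simp only [Prod.mk_add_mk, Prod.mk.injEq, Matrix.add_apply, and_true]
    constructor <;> noncomm_ring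
  map_smul' c X := by
    simp [smul_sub]

lemma sysMap_apply {n : ℕ} (i₀ : Fin n) (u v X : Matrix (Fin n) (Fin n) ℂ) :
    sysMap i₀ u v X =
      (X * (v * v) - (v * v) * X, (v * v * u) * X - X * (v * u * v), X i₀ i₀) := rfl

/-- If the system is injective and `(v²)₀₀ ≠ 0`, then `v` is determined up to sign. -/
lemma unique_of_inj {n : ℕ} (i₀ : Fin n) (u v : Matrix (Fin n) (Fin n) ℂ)
    (hinj : ∀ X, sysMap i₀ u v X = 0 → X = 0) (hv : (v * v) i₀ i₀ ≠ 0)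
    (x : Matrix (Fin n) (Fin n) ℂ) (h1 : x * x = v * v) (h2 : x * u * x = v * u * v) :
    x = v ∨ x = -v := by
  have hvv : v ≠ 0 := by rintro rfl; simp at hv
  have kv1 : v * (v * v) - (v * v) * v = 0 := by noncomm_ring
  have kv2 : (v * v * u) * v - v * (v * u * v) = 0 := by noncomm_ring
  have kx1 : x * (v * v) - (v * v) * x = 0 := by rw [← h1]; noncomm_ring
  have kx2 : (v * v * u) * x - x * (v * u * v) = 0 := by rw [← h1, ← h2]; noncomm_ring
  have hv0 : v i₀ i₀ ≠ 0 := by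
    intro h
    apply hvv
    apply hinj
    rw [sysMap_apply, kv1, kv2, h]; rfl
  set c : ℂ := x i₀ i₀ / v i₀ i₀ with hc
  have hx : x = c • v := by
    rw [← sub_eq_zero]
    apply hinj
    rw [map_sub, map_smul, sysMap_apply, sysMap_apply, kv1, kv2, kx1, kx2]
    simp [hc, div_mul_cancel₀ _ hv0]
  have hcc : c * c = 1 := by
    have := congrFun (congrFun h1 i₀) i₀
    rw [hx] at this
    simp only [smul_mul_assoc, mul_smul_comm, Matrix.smul_apply, smul_eq_mul] at this
    exact mul_right_cancel₀ hv (by rw [mul_assoc, one_mul]; exact this)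
  rcases mul_self_eq_one_iff.mp hcc with h | h
  · left; rw [hx, h, one_smul]
  · right; rw [hx, h, neg_one_smul]

/-- base point -/
def vBase (n : ℕ) : Matrix (Fin n) (Fin n) ℂ := Matrix.diagonal fun i => ((i : ℕ) : ℂ) + 1

/-- base point -/
def uBase (n : ℕ) : Matrix (Fin n) (Fin n) ℂ := Matrix.of fun _ _ => 1

lemma base_inj {n : ℕ} (i₀ : Fin n) (X : Matrix (Fin n) (Fin n) ℂ)
    (h : sysMap i₀ (uBase n) (vBase n) X = 0) : X = 0 := by
  rw [sysMap_apply] at h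
  simp only [Prod.mk_eq_zero] at h
  obtain ⟨h1, h2, h3⟩ := h
  have hpos : ∀ i : Fin n, ((i : ℕ) : ℂ) + 1 ≠ 0 := fun i => Nat.cast_add_one_ne_zero _
  have hoff : ∀ i j, i ≠ j → X i j = 0 := by
    intro i j hij
    have := congrFun (congrFun h1 i) j
    simp only [vBase, Matrix.diagonal_mul_diagonal, Matrix.sub_apply, Matrix.mul_diagonal,
      Matrix.diagonal_mul, Matrix.zero_apply] at this
    have hne : (((j : ℕ) : ℂ) + 1) * (((j : ℕ) : ℂ) + 1)
        - (((i : ℕ) : ℂ) + 1) * (((i : ℕ) : ℂ) + 1) ≠ 0 := by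
      rw [sub_ne_zero]
      intro h
      apply hij
      have h' : ((j : ℕ) + 1) * ((j : ℕ) + 1) = ((i : ℕ) + 1) * ((i : ℕ) + 1) := by
        exact_mod_cast h
      have := Nat.mul_self_inj.mp h'
      exact Fin.ext (by omega)
    have h' : X i j * ((((j : ℕ) : ℂ) + 1) * (((j : ℕ) : ℂ) + 1)
        - (((i : ℕ) : ℂ) + 1) * (((i : ℕ) : ℂ) + 1)) = 0 := by
      linear_combination this
    exact (mul_eq_zero.mp h').resolve_right hne
  have hX : X = Matrix.diagonal (fun i => X i i) := by
    ext i j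
    by_cases hij : i = j
    · subst hij; simp
    · rw [Matrix.diagonal_apply_ne _ hij, hoff i j hij]
  set d := fun i => X i i with hd
  have hdiag : ∀ j, d j = 0 := by
    intro j
    have := congrFun (congrFun h2 i₀) j
    rw [hX] at this
    simp only [vBase, Matrix.diagonal_mul_diagonal, Matrix.sub_apply, Matrix.mul_diagonal,
      Matrix.diagonal_mul, Matrix.zero_apply, uBase, Matrix.of_apply] at this
    have h0 : d i₀ = 0 := h3
    rw [h0] at this
    simpa [hpos] using this
  rw [hX]
  ext i j
  by_cases hij : i = j
  · subst hij; simp [hdiag]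
  · rw [Matrix.diagonal_apply_ne _ hij]; rfl

section
attribute [local instance] Matrix.linftyOpNormedRing Matrix.linftyOpNormedAlgebra

lemma eventually_ne_zero_of_line (f : ℂ → ℂ) (hf : Differentiable ℂ f) (h1 : f 1 ≠ 0) :
    ∀ᶠ t in 𝓝[≠] (0 : ℂ), f t ≠ 0 := by
  by_contra h
  have hfr : ∃ᶠ t in 𝓝[≠] (0 : ℂ), f t = 0 := by
    rw [Filter.Frequently]; exact h
  have han : AnalyticOnNhd ℂ f Set.univ := fun z _ => hf.analyticAt z
  exact h1 (han.eqOn_zero_of_preconnected_of_frequently_eq_zero isPreconnected_univ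
    (Set.mem_univ 0) hfr (Set.mem_univ 1))

lemma eventually_good {n : ℕ} (i₀ : Fin n) (u v : Matrix (Fin n) (Fin n) ℂ) :
    ∀ᶠ t : ℂ in 𝓝[≠] 0,
      (∀ X, sysMap i₀ (u + t • (uBase n - u)) (v + t • (vBase n - v)) X = 0 → X = 0) ∧
      ((v + t • (vBase n - v)) * (v + t • (vBase n - v))) i₀ i₀ ≠ 0 := by
  have hentry : ∀ i j, Differentiable ℂ (fun M : Matrix (Fin n) (Fin n) ℂ => M i j) := by
    intro i j
    exact (LinearMap.toContinuousLinearMap (Matrix.entryLinearMap ℂ ℂ i j)).differentiable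
  have hU : Differentiable ℂ (fun t : ℂ => u + t • (uBase n - u)) := by fun_prop
  have hV : Differentiable ℂ (fun t : ℂ => v + t • (vBase n - v)) := by fun_prop
  refine Filter.Eventually.and ?_ ?_
  · obtain ⟨R, hR⟩ := LinearMap.exists_leftInverse_of_injective
      (sysMap i₀ (uBase n) (vBase n)) (LinearMap.ker_eq_bot'.mpr (base_inj i₀))
    let b := Matrix.stdBasis ℂ (Fin n) (Fin n)
    let G : ℂ → Matrix (Fin n × Fin n) (Fin n × Fin n) ℂ := fun t =>
      LinearMap.toMatrix b b (R ∘ₗ sysMap i₀ (u + t • (uBase n - u)) (v + t • (vBase n - v)))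
    have hG : ∀ p q, Differentiable ℂ (fun t => G t p q) := by
      intro p q
      have hL : Differentiable ℂ (fun t : ℂ =>
          sysMap i₀ (u + t • (uBase n - u)) (v + t • (vBase n - v)) (b q)) := by
        simp only [sysMap_apply]
        fun_prop
      have := (LinearMap.toContinuousLinearMap ((b.coord p) ∘ₗ R)).differentiable.comp hL
      have heq : (fun t => G t p q) = (fun t : ℂ => (b.coord p ∘ₗ R)
          (sysMap i₀ (u + t • (uBase n - u)) (v + t • (vBase n - v)) (b q))) := by
        funext t
        simp [G, LinearMap.toMatrix_apply]
      rw [heq]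
      exact this
    have hdet : Differentiable ℂ (fun t => (G t).det) := by
      simp only [Matrix.det_apply]
      fun_prop
    have h1 : (G 1).det ≠ 0 := by
      simp [G, hR]
    filter_upwards [eventually_ne_zero_of_line _ hdet h1] with t ht X hX
    have hX' : (LinearMap.toMatrix b b
        (R ∘ₗ sysMap i₀ (u + t • (uBase n - u)) (v + t • (vBase n - v)))).mulVec
        (b.repr X) = 0 := by
      rw [LinearMap.toMatrix_mulVec_repr]
      simp [hX]
    have := Matrix.eq_zero_of_mulVec_eq_zero ht hX'
    apply b.repr.map_eq_zero_iff.mp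
    ext i
    exact congrFun this i
  · refine eventually_ne_zero_of_line (fun t : ℂ =>
      ((v + t • (vBase n - v)) * (v + t • (vBase n - v))) i₀ i₀) ?_ ?_
    · exact (hentry i₀ i₀).comp (hV.mul hV)
    · simp [vBase, Nat.cast_add_one_ne_zero]

end

/-- For every `n ≥ 1`, the set of pairs `w` of `n × n` matrices with `w ≠ wᶠ` such that
the only pairs `w'` with `π(w') = π(w)` are `w` and `wᶠ` (so `π⁻¹(π(w))` has cardinality
exactly `2`) is dense in `Mₙ(ℂ)²`. -/
theorem dense_two_to_one {n : ℕ} (hn : 1 ≤ n) :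
    Dense {w : Matrix (Fin n) (Fin n) ℂ × Matrix (Fin n) (Fin n) ℂ |
      (w.2, w.1) ≠ w ∧
      ∀ w' : Matrix (Fin n) (Fin n) ℂ × Matrix (Fin n) (Fin n) ℂ,
        piMap w' = piMap w → w' = w ∨ w' = (w.2, w.1)} := by
  have hrec : ∀ w : Matrix (Fin n) (Fin n) ℂ × Matrix (Fin n) (Fin n) ℂ,
      w = (uOf w + vOf w, uOf w - vOf w) := by
    intro w
    ext i j <;> simp [uOf, vOf] <;> ring
  have huOf : ∀ u v : Matrix (Fin n) (Fin n) ℂ, uOf (u + v, u - v) = u := by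
    intro u v
    ext i j; simp [uOf]; ring
  have hvOf : ∀ u v : Matrix (Fin n) (Fin n) ℂ, vOf (u + v, u - v) = v := by
    intro u v
    ext i j; simp [vOf]; ring
  intro w
  let i₀ : Fin n := ⟨0, hn⟩
  let U : ℂ → Matrix (Fin n) (Fin n) ℂ := fun t => uOf w + t • (uBase n - uOf w)
  let V : ℂ → Matrix (Fin n) (Fin n) ℂ := fun t => vOf w + t • (vBase n - vOf w)
  have hcont : Continuous (fun t : ℂ => (U t + V t, U t - V t)) := by
    simp only [U, V]; fun_prop
  have htend : Filter.Tendsto (fun t : ℂ => (U t + V t, U t - V t)) (𝓝[≠] 0) (𝓝 w) := by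
    have h := (hcont.tendsto 0).mono_left (nhdsWithin_le_nhds (s := {0}ᶜ))
    have h0 : (U 0 + V 0, U 0 - V 0) = w := by
      conv_rhs => rw [hrec w]
      simp [U, V]
    rwa [h0] at h
  refine mem_closure_of_tendsto htend ?_
  filter_upwards [eventually_good i₀ (uOf w) (vOf w)] with t ht
  obtain ⟨hinj, hne⟩ := ht
  change ∀ X, sysMap i₀ (U t) (V t) X = 0 → X = 0 at hinj
  change (V t * V t) i₀ i₀ ≠ 0 at hne
  generalize U t = a at *
  generalize V t = b at *
  refine ⟨?_, ?_⟩
  · intro h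
    apply hne
    have h1 : vOf (a + b, a - b) = b := hvOf a b
    have h2 : a - b = a + b := (Prod.ext_iff.mp h).1
    have hb : b = 0 := by
      rw [← h1, vOf]; simp [h2]
    simp [hb]
  · intro w' hw'
    simp only [piMap, huOf, hvOf, Prod.mk.injEq] at hw'
    obtain ⟨e1, e2, e3⟩ := hw'
    rw [e1] at e3
    rw [hrec w', e1]
    rcases unique_of_inj i₀ a b hinj hne _ e2 e3 with h | h
    · left; rw [h]
    · right; rw [h]; simp [sub_eq_add_neg]
end
end

section
/- There exist pairs w = (w¹, w²) and W = (W¹, W²) of 4×4 complex matrices with ‖w¹‖ < 1, ‖w²‖ < 1, ‖W¹‖ < 1, ‖W²‖ < 1 (operator norm), such that π(w) = π(W) but (w¹ − w²)(w¹ + w²)²(w¹ − w²) ≠ (W¹ − W²)(W¹ + W²)²(W¹ − W²). Consequently, there is no function F defined on the image of the nc bidisc under π that satisfies F(π(w)) = (w¹ − w²)(w¹ + w²)²(w¹ − w²) for all pairs w of strict contractions. -/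
open Topology

noncomputable section

def exMat (a : ℂ) : Matrix (Fin 4) (Fin 4) ℂ :=
  !![0, 0, 0, 0; a, 0, 0, a; 0, 1/4, 0, 0; 0, 0, 1/4, 0]

theorem opNorm_exMat (a : ℂ) (ha : ‖a‖ ≤ 1/4) : opNorm (exMat a) < 1 := by
  have h : opNorm (exMat a) ≤ 1/2 := by
    unfold opNorm
    refine ContinuousLinearMap.opNorm_le_bound _ (by norm_num) ?_
    intro x
    have key : ‖a * x 0 + a * x 3‖ ≤ 1/4 * (‖x 0‖ + ‖x 3‖) := by
      rw [← mul_add, norm_mul]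
      exact mul_le_mul ha (norm_add_le _ _) (norm_nonneg _) (by norm_num)
    have key2 : ‖a * x 0 + a * x 3‖ ^ 2 ≤ (1/4 * (‖x 0‖ + ‖x 3‖)) ^ 2 :=
      pow_le_pow_left₀ (norm_nonneg _) key 2
    refine (sq_le_sq₀ (norm_nonneg _) (by positivity)).1 ?_
    rw [mul_pow, EuclideanSpace.norm_sq_eq, EuclideanSpace.norm_sq_eq]
    simp [Matrix.toLpLin_apply, exMat, Fin.sum_univ_four, Matrix.mulVec, dotProduct, mul_pow]
    nlinarith [sq_nonneg (‖x 0‖ - ‖x 3‖), sq_nonneg ‖x 1‖, sq_nonneg ‖x 2‖,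
      sq_nonneg ‖x 0‖, sq_nonneg ‖x 3‖]
  linarith

/-- There are pairs `w, W` of strict `4 × 4` contractions with `π(w) = π(W)` but
`(w¹-w²)(w¹+w²)²(w¹-w²) ≠ (W¹-W²)(W¹+W²)²(W¹-W²)`; consequently no graded function `F` on
the image of the nc bidisc under `π` satisfies `F(π(w)) = (w¹-w²)(w¹+w²)²(w¹-w²)` for all
pairs of strict contractions. -/
theorem pascoe_example :
    (∃ w W : Matrix (Fin 4) (Fin 4) ℂ × Matrix (Fin 4) (Fin 4) ℂ,
      opNorm w.1 < 1 ∧ opNorm w.2 < 1 ∧ opNorm W.1 < 1 ∧ opNorm W.2 < 1 ∧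
      piMap w = piMap W ∧
      (w.1 - w.2) * (w.1 + w.2) ^ 2 * (w.1 - w.2) ≠
        (W.1 - W.2) * (W.1 + W.2) ^ 2 * (W.1 - W.2)) ∧
    ¬ ∃ F : ∀ n : ℕ, (Matrix (Fin n) (Fin n) ℂ × Matrix (Fin n) (Fin n) ℂ ×
          Matrix (Fin n) (Fin n) ℂ) → Matrix (Fin n) (Fin n) ℂ,
        ∀ (n : ℕ) (w : Matrix (Fin n) (Fin n) ℂ × Matrix (Fin n) (Fin n) ℂ),
          opNorm w.1 < 1 → opNorm w.2 < 1 →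
          F n (piMap w) = (w.1 - w.2) * (w.1 + w.2) ^ 2 * (w.1 - w.2) := by
  have h1 : opNorm (exMat (1/4)) < 1 := opNorm_exMat _ (by norm_num)
  have h2 : opNorm (exMat (-1/4)) < 1 := opNorm_exMat _ (by norm_num)
  have h3 : opNorm (exMat 0) < 1 := opNorm_exMat _ (by norm_num)
  have hv : exMat (1/4) - exMat (-1/4) = !![0, 0, 0, 0; 1/2, 0, 0, 1/2; 0, 0, 0, 0; 0, 0, 0, 0] := by
    ext i j
    fin_cases i <;> fin_cases j <;> simp [exMat] <;> norm_num
  have hu : exMat (1/4) + exMat (-1/4) = !![0, 0, 0, 0; 0, 0, 0, 0; 0, 1/2, 0, 0; 0, 0, 1/2, 0] := by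
    ext i j
    fin_cases i <;> fin_cases j <;> simp [exMat] <;> norm_num
  have hu0 : exMat 0 + exMat 0 = !![0, 0, 0, 0; 0, 0, 0, 0; 0, 1/2, 0, 0; 0, 0, 1/2, 0] := by
    ext i j
    fin_cases i <;> fin_cases j <;> simp [exMat] <;> norm_num
  have hpi : piMap (exMat (1/4), exMat (-1/4)) = piMap (exMat 0, exMat 0) := by
    simp only [piMap, uOf, vOf, hv, hu, hu0, sub_self, smul_zero, zero_mul, Prod.mk.injEq,
      true_and]
    constructor <;>
    · ext i j
      fin_cases i <;> fin_cases j <;> simp [Matrix.mul_apply, Fin.sum_univ_four]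
  have hne : (exMat (1/4) - exMat (-1/4)) * (exMat (1/4) + exMat (-1/4)) ^ 2 *
      (exMat (1/4) - exMat (-1/4)) ≠
      (exMat 0 - exMat 0) * (exMat 0 + exMat 0) ^ 2 * (exMat 0 - exMat 0) := by
    intro h
    rw [hv, hu, sub_self, zero_mul, zero_mul] at h
    have := congrFun (congrFun h 1) 0
    simp [pow_two, Matrix.mul_apply, Fin.sum_univ_four] at this
  refine ⟨⟨(exMat (1/4), exMat (-1/4)), (exMat 0, exMat 0), h1, h2, h3, h3, hpi, hne⟩, ?_⟩
  rintro ⟨F, hF⟩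
  have e1 := hF 4 (exMat (1/4), exMat (-1/4)) h1 h2
  have e2 := hF 4 (exMat 0, exMat 0) h3 h3
  rw [hpi, e2] at e1
  exact hne e1.symm
end
end

section
/- Let d ≥ 1, let D ⊆ M^d be closed under direct sums, and let T ⊆ D be such that D ∖ T is nonempty and z ⊕ w ∈ D ∖ T whenever z ∈ D and w ∈ D ∖ T. Let φ be a graded function on D ∖ T (i.e. φ(x) ∈ Mₙ(ℂ) whenever x ∈ Mₙ^d ∩ (D ∖ T)) which preserves direct sums (φ(x ⊕ y) = φ(x) ⊕ φ(y) whenever x, y, x ⊕ y ∈ D ∖ T) and preserves intertwinings (whenever x ∈ Mₙ^d ∩ (D ∖ T), y ∈ Mₘ^d ∩ (D ∖ T) and Λ is an n×m complex matrix with x^j Λ = Λ y^j for j = 1,…,d, then φ(x) Λ = Λ φ(y)). Then φ extends to a graded function φ̂ on D which preserves direct sums (φ̂(x ⊕ y) = φ̂(x) ⊕ φ̂(y) whenever x, y, x ⊕ y ∈ D) and preserves similarities (φ̂(s⁻¹xs) = s⁻¹φ̂(x)s whenever x ∈ Mₙ^d ∩ D, s ∈ GLₙ(ℂ), and s⁻¹xs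 ∈ D); this extension is the unique direct-sum-preserving graded extension of φ to D; and if ‖φ(x)‖ ≤ C for all x ∈ D ∖ T, then ‖φ̂(x)‖ ≤ C for all x ∈ D. -/
open Topology

noncomputable section

/-- The inclusion of the first summand. -/
def incl1 (n m : ℕ) : Matrix (Fin (n + m)) (Fin n) ℂ :=
  (Matrix.fromRows (1 : Matrix (Fin n) (Fin n) ℂ) (0 : Matrix (Fin m) (Fin n) ℂ)).submatrix
    finSumFinEquiv.symm (Equiv.refl _)

/-- The inclusion of the second summand. -/
def incl2 (n m : ℕ) : Matrix (Fin (n + m)) (Fin m) ℂ :=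
  (Matrix.fromRows (0 : Matrix (Fin n) (Fin m) ℂ) (1 : Matrix (Fin m) (Fin m) ℂ)).submatrix
    finSumFinEquiv.symm (Equiv.refl _)

open Matrix

/-- Compression to the first summand. -/
def compress {n m : ℕ} (A : Matrix (Fin (n + m)) (Fin (n + m)) ℂ) : Matrix (Fin n) (Fin n) ℂ :=
  (incl1 n m)ᴴ * A * incl1 n m

lemma incl1_self (n m : ℕ) : (incl1 n m)ᴴ * incl1 n m = 1 := by
  unfold incl1
  rw [Matrix.conjTranspose_submatrix, Matrix.submatrix_mul_equiv,
    Matrix.conjTranspose_fromRows_eq_fromCols_conjTranspose, Matrix.fromCols_mul_fromRows]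
  simp

lemma oplus_incl1 {n m : ℕ} (a : Matrix (Fin n) (Fin n) ℂ) (b : Matrix (Fin m) (Fin m) ℂ) :
    oplus a b * incl1 n m = incl1 n m * a := by
  have h : a = a.submatrix (Equiv.refl _) (Equiv.refl _) := rfl
  conv_rhs => rw [h]
  unfold incl1 oplus
  rw [Matrix.reindex_apply, Matrix.submatrix_mul_equiv, Matrix.submatrix_mul_equiv,
    Matrix.fromBlocks_mul_fromRows, Matrix.fromRows_mul]
  simp

lemma oplus_incl2 {n m : ℕ} (a : Matrix (Fin n) (Fin n) ℂ) (b : Matrix (Fin m) (Fin m) ℂ) :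
    oplus a b * incl2 n m = incl2 n m * b := by
  have h : b = b.submatrix (Equiv.refl _) (Equiv.refl _) := rfl
  conv_rhs => rw [h]
  unfold incl2 oplus
  rw [Matrix.reindex_apply, Matrix.submatrix_mul_equiv, Matrix.submatrix_mul_equiv,
    Matrix.fromBlocks_mul_fromRows, Matrix.fromRows_mul]
  simp

lemma oplus_conjTranspose {n m : ℕ} (a : Matrix (Fin n) (Fin n) ℂ)
    (b : Matrix (Fin m) (Fin m) ℂ) : (oplus a b)ᴴ = oplus aᴴ bᴴ := by
  unfold oplus
  simp [Matrix.conjTranspose_submatrix, Matrix.fromBlocks_conjTranspose]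

lemma incl1_oplus {n m : ℕ} (a : Matrix (Fin n) (Fin n) ℂ) (b : Matrix (Fin m) (Fin m) ℂ) :
    (incl1 n m)ᴴ * oplus a b = a * (incl1 n m)ᴴ := by
  have h := congrArg Matrix.conjTranspose (oplus_incl1 aᴴ bᴴ)
  simpa [Matrix.conjTranspose_mul, oplus_conjTranspose] using h

lemma incl_sum (n m : ℕ) :
    incl1 n m * (incl1 n m)ᴴ + incl2 n m * (incl2 n m)ᴴ = 1 := by
  unfold incl1 incl2
  rw [Matrix.conjTranspose_submatrix, Matrix.conjTranspose_submatrix,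
    Matrix.submatrix_mul_equiv, Matrix.submatrix_mul_equiv,
    Matrix.conjTranspose_fromRows_eq_fromCols_conjTranspose,
    Matrix.conjTranspose_fromRows_eq_fromCols_conjTranspose,
    Matrix.fromRows_mul_fromCols, Matrix.fromRows_mul_fromCols]
  have key : ∀ A B : Matrix (Fin n ⊕ Fin m) (Fin n ⊕ Fin m) ℂ,
      A.submatrix finSumFinEquiv.symm finSumFinEquiv.symm
        + B.submatrix finSumFinEquiv.symm finSumFinEquiv.symm
        = (A + B).submatrix (finSumFinEquiv (m := n) (n := m)).symm finSumFinEquiv.symm :=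
    fun A B => rfl
  rw [key]
  simp [Matrix.fromBlocks_add, Matrix.fromBlocks_one]

lemma compress_oplus {n m : ℕ} (a : Matrix (Fin n) (Fin n) ℂ) (b : Matrix (Fin m) (Fin m) ℂ) :
    (incl1 n m)ᴴ * oplus a b * incl1 n m = a := by
  rw [incl1_oplus, Matrix.mul_assoc, incl1_self, Matrix.mul_one]

lemma eq_oplus {n m : ℕ} (A : Matrix (Fin (n + m)) (Fin (n + m)) ℂ)
    (a : Matrix (Fin n) (Fin n) ℂ) (b : Matrix (Fin m) (Fin m) ℂ)
    (h1 : A * incl1 n m = incl1 n m * a) (h2 : A * incl2 n m = incl2 n m * b) :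
    A = oplus a b := by
  rw [← Matrix.mul_one A, ← Matrix.mul_one (oplus a b), ← incl_sum, Matrix.mul_add,
    Matrix.mul_add, ← Matrix.mul_assoc, ← Matrix.mul_assoc, ← Matrix.mul_assoc,
    ← Matrix.mul_assoc, h1, h2, oplus_incl1, oplus_incl2]

lemma lift_intertwine {n m k : ℕ} (a : Matrix (Fin n) (Fin n) ℂ) (b : Matrix (Fin m) (Fin m) ℂ)
    (w : Matrix (Fin k) (Fin k) ℂ) (L : Matrix (Fin n) (Fin m) ℂ) (h : a * L = L * b) :
    oplus a w * (incl1 n k * L * (incl1 m k)ᴴ) = (incl1 n k * L * (incl1 m k)ᴴ) * oplus b w := by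
  rw [Matrix.mul_assoc _ _ (oplus b w), incl1_oplus, ← Matrix.mul_assoc, ← Matrix.mul_assoc,
    oplus_incl1, Matrix.mul_assoc (incl1 n k) a L, h]
  simp only [Matrix.mul_assoc]

lemma compress_intertwine {n m k : ℕ} (A : Matrix (Fin (n + k)) (Fin (n + k)) ℂ)
    (B : Matrix (Fin (m + k)) (Fin (m + k)) ℂ) (L : Matrix (Fin n) (Fin m) ℂ)
    (h : A * (incl1 n k * L * (incl1 m k)ᴴ) = (incl1 n k * L * (incl1 m k)ᴴ) * B) :
    ((incl1 n k)ᴴ * A * incl1 n k) * L = L * ((incl1 m k)ᴴ * B * incl1 m k) := by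
  calc ((incl1 n k)ᴴ * A * incl1 n k) * L
      = (incl1 n k)ᴴ * (A * (incl1 n k * L * (incl1 m k)ᴴ)) * incl1 m k := by
        simp only [Matrix.mul_assoc, incl1_self, Matrix.mul_one]
    _ = ((incl1 n k)ᴴ * incl1 n k) * L * ((incl1 m k)ᴴ * B * incl1 m k) := by
        rw [h]; simp only [Matrix.mul_assoc]
    _ = _ := by rw [incl1_self, Matrix.one_mul]

open scoped Matrix.Norms.L2Operator in
lemma opNorm_compress_s18 {n m : ℕ} (A : Matrix (Fin (n + m)) (Fin (n + m)) ℂ) :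
    opNorm ((incl1 n m)ᴴ * A * incl1 n m) ≤ opNorm A := by
  change ‖(incl1 n m)ᴴ * A * incl1 n m‖ ≤ ‖A‖
  have h1 : ‖incl1 n m‖ ≤ 1 := by
    have h := Matrix.l2_opNorm_conjTranspose_mul_self (incl1 n m)
    rw [incl1_self] at h
    have h2 : ‖(1 : Matrix (Fin n) (Fin n) ℂ)‖ ≤ 1 := by
      rw [Matrix.l2_opNorm_def]
      refine ContinuousLinearMap.opNorm_le_bound _ zero_le_one fun v => ?_
      simp
    nlinarith [norm_nonneg (incl1 n m)]
  have h2 : ‖(incl1 n m)ᴴ‖ ≤ 1 := by rwa [Matrix.l2_opNorm_conjTranspose]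
  calc ‖(incl1 n m)ᴴ * A * incl1 n m‖ ≤ ‖(incl1 n m)ᴴ * A‖ * ‖incl1 n m‖ := Matrix.l2_opNorm_mul _ _
    _ ≤ (‖(incl1 n m)ᴴ‖ * ‖A‖) * ‖incl1 n m‖ := by gcongr; exact Matrix.l2_opNorm_mul _ _
    _ ≤ (1 * ‖A‖) * 1 := by gcongr
    _ = ‖A‖ := by ring

/-- Extension of direct-sum- and intertwining-preserving graded functions from `D ∖ T` to
`D`: the extension preserves direct sums and similarities, is the unique
direct-sum-preserving graded extension, and satisfies the same uniform bounds. -/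
theorem graded_extension (d : ℕ) (D T : Set (Md d)) (hTD : T ⊆ D)
    (hDsum : ∀ x ∈ D, ∀ y ∈ D, dsum x y ∈ D)
    (hne : (D \ T).Nonempty)
    (habs : ∀ z ∈ D, ∀ w ∈ D \ T, dsum z w ∈ D \ T)
    (φ : ∀ x : Md d, Matrix (Fin (x.1 + 1)) (Fin (x.1 + 1)) ℂ)
    (hds : ∀ x ∈ D \ T, ∀ y ∈ D \ T, dsum x y ∈ D \ T →
      φ (dsum x y) = oplus (φ x) (φ y))
    (hint : ∀ x ∈ D \ T, ∀ y ∈ D \ T,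
      ∀ Λ : Matrix (Fin (x.1 + 1)) (Fin (y.1 + 1)) ℂ,
        (∀ j, x.2 j * Λ = Λ * y.2 j) → φ x * Λ = Λ * φ y) :
    ∃ ψ : ∀ x : Md d, Matrix (Fin (x.1 + 1)) (Fin (x.1 + 1)) ℂ,
      (∀ x ∈ D \ T, ψ x = φ x) ∧
      (∀ x ∈ D, ∀ y ∈ D, dsum x y ∈ D → ψ (dsum x y) = oplus (ψ x) (ψ y)) ∧
      (∀ x ∈ D, ∀ s : Matrix (Fin (x.1 + 1)) (Fin (x.1 + 1)) ℂ, IsUnit s →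
        (⟨x.1, fun j => s⁻¹ * x.2 j * s⟩ : Md d) ∈ D →
        ψ ⟨x.1, fun j => s⁻¹ * x.2 j * s⟩ = s⁻¹ * ψ x * s) ∧
      (∀ ψ' : ∀ x : Md d, Matrix (Fin (x.1 + 1)) (Fin (x.1 + 1)) ℂ,
        (∀ x ∈ D \ T, ψ' x = φ x) →
        (∀ x ∈ D, ∀ y ∈ D, dsum x y ∈ D → ψ' (dsum x y) = oplus (ψ' x) (ψ' y)) →
        ∀ x ∈ D, ψ' x = ψ x) ∧
      (∀ C : ℝ, (∀ x ∈ D \ T, opNorm (φ x) ≤ C) → ∀ x ∈ D, opNorm (ψ x) ≤ C) := by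
  obtain ⟨w, hw⟩ := hne
  let ψ : ∀ x : Md d, Matrix (Fin (x.1 + 1)) (Fin (x.1 + 1)) ℂ := fun x =>
    compress (n := x.1 + 1) (m := w.1 + 1) (φ (dsum x w))
  have hψ : ∀ x ∈ D, ∀ y ∈ D, ∀ L : Matrix (Fin (x.1 + 1)) (Fin (y.1 + 1)) ℂ,
      (∀ j, x.2 j * L = L * y.2 j) → ψ x * L = L * ψ y := by
    intro x hx y hy L hL
    refine compress_intertwine (n := x.1 + 1) (m := y.1 + 1) (k := w.1 + 1)
      (φ (dsum x w)) (φ (dsum y w)) L ?_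
    exact hint (dsum x w) (habs x hx w hw) (dsum y w) (habs y hy w hw)
      (incl1 (x.1 + 1) (w.1 + 1) * L * (incl1 (y.1 + 1) (w.1 + 1))ᴴ)
      (fun j => lift_intertwine (x.2 j) (y.2 j) (w.2 j) L (hL j))
  have hcomp : ∀ x : Md d, ∀ a : Matrix (Fin (x.1 + 1)) (Fin (x.1 + 1)) ℂ,
      φ (dsum x w) = oplus a (φ w) → ψ x = a := by
    intro x a h
    have h2 := compress_oplus a (φ w)
    rw [← h] at h2
    exact h2
  refine ⟨ψ, ?_, ?_, ?_, ?_, ?_⟩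
  · intro x hx
    exact hcomp x _ (hds x hx w hw (habs x hx.1 w hw))
  · intro x hx y hy hxy
    refine eq_oplus (n := x.1 + 1) (m := y.1 + 1) (ψ (dsum x y)) _ _ ?_ ?_
    · exact hψ (dsum x y) hxy x hx (incl1 (x.1 + 1) (y.1 + 1))
        (fun j => oplus_incl1 (x.2 j) (y.2 j))
    · exact hψ (dsum x y) hxy y hy (incl2 (x.1 + 1) (y.1 + 1))
        (fun j => oplus_incl2 (x.2 j) (y.2 j))
  · intro x hx s hs hxs
    have hdet : IsUnit s.det := (Matrix.isUnit_iff_isUnit_det s).mp hs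
    have h := hψ x hx ⟨x.1, fun j => s⁻¹ * x.2 j * s⟩ hxs s (fun j => by
      change x.2 j * s = s * (s⁻¹ * x.2 j * s)
      rw [← Matrix.mul_assoc, Matrix.mul_nonsing_inv_cancel_left _ _ hdet])
    rw [Matrix.mul_assoc, h]
    exact (Matrix.nonsing_inv_mul_cancel_left _ _ hdet).symm
  · intro ψ' h1 h2 x hx
    refine (hcomp x _ ?_).symm
    rw [← h1 _ (habs x hx w hw), ← h1 w hw]
    exact h2 x hx w hw.1 (hDsum x hx w hw.1)
  · intro C hC x hx
    exact (opNorm_compress_s18 (n := x.1 + 1) (m := w.1 + 1) (φ (dsum x w))).trans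
      (hC _ (habs x hx w hw))
end
end
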